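/- arXiv:1901.01309 — 5 statements merged into one kernel-verified Lean document; each statement's English description precedes it below -/
import Mathlib

section
/- Let q ≥ 1, let S, F be real q×q matrices with disjoint complex spectra, let E be a real 1×q matrix and G a real q×1 matrix. Assume the pair (F, G) is controllable, i.e. the q×q controllability matrix [G, FG, …, F^{q−1}G] has rank q, and the pair (E, S) is observable, i.e. the q×q observability matrix with rows E, ES, …, ES^{q−1} has rank q. Then the unique real q×q matrix M solving M S = F M + G E is nonsingular. -/
open Polynomial in
lemma aux_tele {q : ℕ} (S F M : Matrix (Fin q) (Fin q) ℝ) (K : Matrix (Fin q) (Fin q) ℝ)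
    (h : M * S = F * M + K) (p : ℝ[X]) (hp : p.natDegree ≤ q) :
    M * aeval S p = aeval F p * M +
      ∑ i ∈ Finset.range q, ∑ j ∈ Finset.range q, p.coeff (i + j + 1) • (F ^ i * K * S ^ j) := by
  let T : ℕ → Matrix (Fin q) (Fin q) ℝ := fun i =>
    ∑ j ∈ Finset.range (q + 1), p.coeff (i + j) • S ^ j
  have hT1 : ∀ i, T (i + 1) = ∑ j ∈ Finset.range q, p.coeff (i + j + 1) • S ^ j := by
    intro i
    simp only [T]
    rw [Finset.sum_range_succ, coeff_eq_zero_of_natDegree_lt (n := i + 1 + q) (by omega)]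
    rw [zero_smul, add_zero]
    refine Finset.sum_congr rfl fun j _ => ?_
    rw [show i + 1 + j = i + j + 1 by ring]
  have hT : ∀ i, T i = S * T (i + 1) + p.coeff i • 1 := by
    intro i
    rw [hT1]
    simp only [T]
    rw [Finset.sum_range_succ', Finset.mul_sum]
    congr 1
    · refine Finset.sum_congr rfl fun j _ => ?_
      rw [Matrix.mul_smul, pow_succ', add_assoc]

  have hT0 : T 0 = aeval S p := by
    rw [aeval_eq_sum_range' (n := q + 1) (by omega)]
    simp [T]
  have key : ∀ n, M * T 0 = (∑ i ∈ Finset.range n, p.coeff i • F ^ i) * M +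
      ∑ i ∈ Finset.range n, F ^ i * K * T (i + 1) + F ^ n * M * T n := by
    intro n
    induction n with
    | zero => simp
    | succ n ih =>
      rw [ih, Finset.sum_range_succ, Finset.sum_range_succ]
      have : F ^ n * M * T n = F ^ n * (M * S) * T (n + 1) + p.coeff n • (F ^ n * M) := by
        conv_lhs => rw [hT n]
        rw [mul_add, Matrix.mul_smul, mul_one]
        simp only [mul_assoc]
      rw [this, h, pow_succ, add_mul, Matrix.smul_mul]
      simp only [mul_add, add_mul, mul_assoc]
      abel
  have hz : T (q + 1) = 0 := by
    rw [hT1]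
    refine Finset.sum_eq_zero fun j _ => ?_
    rw [coeff_eq_zero_of_natDegree_lt (by omega), zero_smul]
  have := key (q + 1)
  rw [hT0, hz, mul_zero, add_zero, ← aeval_eq_sum_range' (n := q + 1) (by omega),
    Finset.sum_range_succ, hz, mul_zero, add_zero] at this
  rw [this]
  congr 1
  refine Finset.sum_congr rfl fun i _ => ?_
  rw [hT1, Finset.mul_sum]
  refine Finset.sum_congr rfl fun j _ => ?_
  rw [Matrix.mul_smul]

open Polynomial in
lemma aux_unit {q : ℕ} (S F : Matrix (Fin q) (Fin q) ℝ)
    (hspec : Disjoint (spectrum ℂ (S.map (algebraMap ℝ ℂ)))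
      (spectrum ℂ (F.map (algebraMap ℝ ℂ)))) : IsUnit (aeval S F.charpoly) := by
  rcases Nat.eq_zero_or_pos q with h0 | h0
  · subst h0
    exact isUnit_of_subsingleton _
  haveI : Nonempty (Fin q) := ⟨⟨0, h0⟩⟩
  have h1 : IsUnit (aeval (S.map (algebraMap ℝ ℂ)) (F.map (algebraMap ℝ ℂ)).charpoly) := by
    rw [← spectrum.zero_notMem_iff ℂ]
    intro h
    rw [spectrum.map_polynomial_aeval_of_nonempty _ _
      (spectrum.nonempty_of_isAlgClosed_of_finiteDimensional ℂ _)] at h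
    obtain ⟨x, hx, hx0⟩ := h
    exact Set.disjoint_left.1 hspec hx (Matrix.mem_spectrum_of_isRoot_charpoly hx0)
  have h2 : aeval (S.map (algebraMap ℝ ℂ)) (F.map (algebraMap ℝ ℂ)).charpoly
      = (aeval S F.charpoly).map (algebraMap ℝ ℂ) := by
    rw [Matrix.charpoly_map]
    have := (Polynomial.map_aeval_eq_aeval_map (S := Matrix (Fin q) (Fin q) ℝ) (T := ℂ)
      (U := Matrix (Fin q) (Fin q) ℂ) (φ := algebraMap ℝ ℂ) (ψ := (algebraMap ℝ ℂ).mapMatrix) ?_ F.charpoly S)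
    · simpa using this.symm
    · ext r i j
      by_cases hij : i = j <;> simp [Matrix.algebraMap_matrix_apply, hij]
  rw [Matrix.isUnit_iff_isUnit_det] at h1 ⊢
  rw [h2] at h1
  rw [isUnit_iff_ne_zero] at h1 ⊢
  intro h
  apply h1
  have := RingHom.map_det (algebraMap ℝ ℂ) (aeval S F.charpoly)
  rw [h, map_zero] at this
  exact this.symm

lemma aux_rank {q : ℕ} (A : Matrix (Fin q) (Fin q) ℝ) (h : A.rank = q) : IsUnit A.det := by
  rw [← Matrix.isUnit_iff_isUnit_det, ← Matrix.mulVec_surjective_iff_isUnit]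
  have : LinearMap.range A.mulVecLin = ⊤ := by
    apply Submodule.eq_top_of_finrank_eq
    rw [Module.finrank_fin_fun]
    exact h
  exact LinearMap.range_eq_top.1 this

lemma aux_hankel {q : ℕ} (p : Polynomial ℝ) (hp : p.natDegree = q) (hm : p.Monic) :
    IsUnit (Matrix.of (fun i j : Fin q => p.coeff (i + j + 1))) := by
  have : IsUnit ((Matrix.of (fun i j : Fin q => p.coeff (i + j + 1))).submatrix
      (Fin.revPerm) (Equiv.refl _)) := by
    rw [Matrix.isUnit_iff_isUnit_det, Matrix.det_of_lowerTriangular]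
    · rw [Finset.prod_eq_one]
      · exact isUnit_one
      · intro i _
        have : q - (i + 1) + i + 1 = p.natDegree := by omega
        simp [this, hm]
    · intro i j hij
      have hij : i < j := hij
      have : (i : ℕ) < j := hij
      simp only [Matrix.submatrix_apply, Matrix.of_apply, Fin.revPerm_apply, Fin.val_rev,
        Equiv.refl_apply]
      exact Polynomial.coeff_eq_zero_of_natDegree_lt (by omega)
  exact (Matrix.isUnit_submatrix_equiv _ _).1 this


/-- **Nikiforov's lemma.** Suppose the real `q × q` matrices `S` and `F` have disjoint complex
spectra, the pair `(F, G)` is controllable (the controllability matrix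
`[G, FG, …, F^{q-1}G]` has rank `q`) and the pair `(E, S)` is observable (the observability
matrix with rows `E, ES, …, ES^{q-1}` has rank `q`).  Then the unique real `q × q` matrix `M`
solving the Sylvester equation `M S = F M + G E` is nonsingular. -/
theorem sylvester_solution_nonsingular (q : ℕ) (hq : 1 ≤ q)
    (S F : Matrix (Fin q) (Fin q) ℝ)
    (E : Matrix (Fin 1) (Fin q) ℝ) (G : Matrix (Fin q) (Fin 1) ℝ)
    (hspec : Disjoint (spectrum ℂ (S.map (algebraMap ℝ ℂ)))
      (spectrum ℂ (F.map (algebraMap ℝ ℂ))))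
    (hctrb : (Matrix.of (fun i j : Fin q => (F ^ (j : ℕ) * G) i 0)).rank = q)
    (hobs : (Matrix.of (fun i j : Fin q => (E * S ^ (i : ℕ)) 0 j)).rank = q) :
    (∃! M : Matrix (Fin q) (Fin q) ℝ, M * S = F * M + G * E) ∧
      ∀ M : Matrix (Fin q) (Fin q) ℝ, M * S = F * M + G * E → IsUnit M.det := by
  have hu := aux_unit S F hspec
  have hdeg : F.charpoly.natDegree = q := by simp [Matrix.charpoly_natDegree_eq_dim]
  constructor
  · let L : Matrix (Fin q) (Fin q) ℝ →ₗ[ℝ] Matrix (Fin q) (Fin q) ℝ :=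
      LinearMap.mulRight ℝ S - LinearMap.mulLeft ℝ F
    have hL : ∀ M, L M = M * S - F * M := fun M => by simp [L]
    have hinj : Function.Injective L := by
      rw [injective_iff_map_eq_zero]
      intro M hM
      rw [hL, sub_eq_zero] at hM
      have := aux_tele S F M 0 (by simpa using hM) F.charpoly hdeg.le
      rw [Matrix.aeval_self_charpoly] at this
      simp only [mul_zero, zero_mul, smul_zero, Finset.sum_const_zero, add_zero] at this
      exact (hu.mul_left_eq_zero).1 this
    obtain ⟨M, hM⟩ := LinearMap.injective_iff_surjective.1 hinj (G * E)
    refine ⟨M, ?_, fun N hN => hinj ?_⟩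
    · rw [hL] at hM
      rw [← hM]
      abel
    · rw [hM, hL]
      have hN : N * S = F * N + G * E := hN
      rw [hN]
      abel
  · intro M hM
    have h1 := aux_tele S F M (G * E) hM F.charpoly hdeg.le
    rw [Matrix.aeval_self_charpoly, zero_mul, zero_add] at h1
    have h2 : M * Polynomial.aeval S F.charpoly =
        (Matrix.of (fun i j : Fin q => (F ^ (j : ℕ) * G) i 0)) *
        ((Matrix.of (fun i j : Fin q => F.charpoly.coeff (i + j + 1))) *
        (Matrix.of (fun i j : Fin q => (E * S ^ (i : ℕ)) 0 j))) := by
      rw [h1]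
      ext a b
      rw [Finset.sum_range]
      simp only [Finset.sum_range, Matrix.sum_apply]
      rw [Matrix.mul_apply]
      refine Finset.sum_congr rfl fun i _ => ?_
      rw [Matrix.mul_apply, Finset.mul_sum]
      refine Finset.sum_congr rfl fun j _ => ?_
      have : F ^ (i : ℕ) * (G * E) * S ^ (j : ℕ) = (F ^ (i : ℕ) * G) * (E * S ^ (j : ℕ)) := by
        simp only [Matrix.mul_assoc]
      rw [this, Matrix.smul_apply, Matrix.mul_apply, Fin.sum_univ_one]
      simp only [Matrix.of_apply, smul_eq_mul]
      ring
    have h3 := congrArg Matrix.det h2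
    rw [Matrix.det_mul, Matrix.det_mul, Matrix.det_mul] at h3
    have h4 := (aux_rank _ hctrb).mul (((Matrix.isUnit_iff_isUnit_det _).1
      (aux_hankel _ hdeg F.charpoly_monic)).mul (aux_rank _ hobs))
    rw [← h3] at h4
    exact isUnit_of_mul_isUnit_left h4
end

section
/- Let n ≥ 1, let F̃ be a real n×n Hurwitz matrix (every complex eigenvalue has negative real part), let G̃ be a real 1×n matrix and H̃ a real n×1 matrix. Then there exists K* ∈ ℝ such that for every K ≥ K*, every solution (e, ξ̃) : ℝ → ℝ × ℝ^n of the linear system ė = −K e + G̃ ξ̃, ξ̃̇ = F̃ ξ̃ + H̃ e satisfies e(t) → 0 and ξ̃(t) → 0 as t → ∞. -/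
open Filter Matrix

/-- A real square matrix is Hurwitz if every complex eigenvalue has negative real part. -/
def IsHurwitz {m : Type*} [Fintype m] [DecidableEq m] (A : Matrix m m ℝ) : Prop :=
  ∀ z ∈ spectrum ℂ (A.map (algebraMap ℝ ℂ)), z.re < 0

theorem aux_pow_tendsto {A : Type*} [NormedRing A] [NormedAlgebra ℂ A] [CompleteSpace A]
    [Nontrivial A] (a : A) (h : ∀ z ∈ spectrum ℂ a, ‖z‖ < 1) :
    Tendsto (fun k : ℕ => a ^ k) atTop (nhds 0) := by
  have h1 : spectralRadius ℂ a < ((1 : NNReal) : ENNReal) := by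
    apply spectrum.spectralRadius_lt_of_forall_lt
    intro z hz
    exact_mod_cast h z hz
  obtain ⟨r, hr1, hr2⟩ := ENNReal.lt_iff_exists_nnreal_btwn.1 h1
  have h2 := (spectrum.pow_nnnorm_pow_one_div_tendsto_nhds_spectralRadius a).eventually_lt_const hr1
  have hr : (r : ℝ) < 1 := by exact_mod_cast hr2
  have h3 : Tendsto (fun k : ℕ => (r : ℝ) ^ k) atTop (nhds 0) :=
    tendsto_pow_atTop_nhds_zero_of_lt_one r.2 hr
  apply squeeze_zero_norm' _ h3
  filter_upwards [h2, eventually_gt_atTop 0] with k hk hk0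
  have hk0' : (0 : ℝ) < k := by exact_mod_cast hk0
  have h4 : ((‖a ^ k‖₊ : ENNReal) ^ (1 / k : ℝ)) ^ (k : ℝ) ≤ (r : ENNReal) ^ (k : ℝ) :=
    ENNReal.rpow_le_rpow hk.le hk0'.le
  rw [← ENNReal.rpow_mul, one_div_mul_cancel hk0'.ne', ENNReal.rpow_one,
    ENNReal.rpow_natCast] at h4
  exact_mod_cast h4

theorem aux_cayley {A : Type*} [Ring A] [Algebra ℂ A] (a b : A) (hb : (a - 1) * b = 1)
    (hb' : b * (a - 1) = 1)
    (h : ∀ z ∈ spectrum ℂ a, z.re < 0) : ∀ z ∈ spectrum ℂ ((a + 1) * b), ‖z‖ < 1 := by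
  intro z hz
  by_contra hlt
  push Not at hlt
  apply hz
  show IsUnit _
  have hbu : IsUnit b := ⟨⟨b, a - 1, hb', hb⟩, rfl⟩
  have e1 : algebraMap ℂ A z - (a + 1) * b
      = (algebraMap ℂ A z * (a - 1) - (a + 1)) * b := by
    rw [sub_mul, mul_assoc, hb, mul_one]
  rw [e1]
  refine IsUnit.mul ?_ hbu
  by_cases hz1 : z = 1
  · subst hz1
    have : algebraMap ℂ A 1 * (a - 1) - (a + 1) = algebraMap ℂ A (-2) := by
      rw [map_neg, map_one, map_ofNat, one_mul, ← one_add_one_eq_two]; abel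
    rw [this]
    exact (IsUnit.mk0 (-2 : ℂ) (by norm_num)).map (algebraMap ℂ A)
  · have hz1' : z - 1 ≠ 0 := sub_ne_zero.2 hz1
    set w := (z + 1) / (z - 1) with hw
    have hwn : w ∉ spectrum ℂ a := by
      intro hws
      have h1 := h w hws
      have h2 : 1 ≤ Complex.normSq z := by
        rw [Complex.normSq_eq_norm_sq]; nlinarith
      have h3 : 0 < Complex.normSq (z - 1) := Complex.normSq_pos.2 hz1'
      rw [hw, Complex.div_re, ← add_div, div_neg_iff] at h1
      rw [Complex.normSq_apply] at h2
      simp at h1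
      rcases h1 with h1 | h1
      · exact hz1' (by linarith [h1.2, h3] : False).elim
      · nlinarith [h1.1]
    have hu : IsUnit (algebraMap ℂ A w - a) := by
      simpa [spectrum, resolventSet] using hwn
    have e2 : algebraMap ℂ A z * (a - 1) - (a + 1)
        = algebraMap ℂ A (-(z - 1)) * (algebraMap ℂ A w - a) := by
      rw [mul_sub (algebraMap ℂ A (-(z - 1))), ← map_mul]
      have : -(z - 1) * w = -(z + 1) := by rw [hw]; field_simp
      rw [this]
      simp only [map_neg, map_add, map_sub, map_one]
      noncomm_ring
    rw [e2]
    exact ((IsUnit.mk0 _ (neg_ne_zero.2 hz1')).map (algebraMap ℂ A)).mul hu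

theorem aux_bound {n : ℕ} (M : Matrix (Fin n) (Fin n) ℝ) (x : Fin n → ℝ) :
    (M *ᵥ x) ⬝ᵥ (M *ᵥ x) ≤ (∑ i, ∑ j, M i j ^ 2) * (x ⬝ᵥ x) := by
  rw [Finset.sum_mul]
  apply Finset.sum_le_sum
  intro i _
  have := Finset.sum_mul_sq_le_sq_mul_sq Finset.univ (fun j => M i j) x
  simp only [dotProduct, mulVec, ← pow_two]
  exact this

theorem aux_stein {n : ℕ} (hn : 1 ≤ n) (F : Matrix (Fin n) (Fin n) ℝ) (hF : IsHurwitz F) :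
    ∃ B : Matrix (Fin n) (Fin n) ℝ, B * (F - 1) = 1 ∧ ∃ N : ℕ, 0 < N ∧
      ∀ x, ((((F + 1) * B) ^ N) *ᵥ x) ⬝ᵥ ((((F + 1) * B) ^ N) *ᵥ x) ≤ (1 / 2) * (x ⬝ᵥ x) := by
  have : NeZero n := ⟨by omega⟩
  let φ : Matrix (Fin n) (Fin n) ℝ →+* Matrix (Fin n) (Fin n) ℂ := (algebraMap ℝ ℂ).mapMatrix
  have hφ : F.map (algebraMap ℝ ℂ) = φ F := rfl
  have hu : IsUnit (F - 1) := by
    rw [Matrix.isUnit_iff_isUnit_det, isUnit_iff_ne_zero]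
    have h1 : (1 : ℂ) ∉ spectrum ℂ (φ F) := fun h => by
      have := hF 1 h
      norm_num at this
    have h2 : IsUnit (algebraMap ℂ (Matrix (Fin n) (Fin n) ℂ) 1 - φ F) := by
      simpa [spectrum, resolventSet] using h1
    have h3 : algebraMap ℂ (Matrix (Fin n) (Fin n) ℂ) 1 - φ F = - φ (F - 1) := by
      simp
    rw [h3, IsUnit.neg_iff, Matrix.isUnit_iff_isUnit_det, isUnit_iff_ne_zero] at h2
    intro h0
    apply h2
    have := RingHom.map_det (algebraMap ℝ ℂ) (F - 1)
    rw [h0, map_zero] at this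
    exact this.symm
  obtain ⟨⟨u, B, hB1, hB2⟩, rfl'⟩ := hu
  simp only at rfl'
  subst rfl'
  refine ⟨B, hB2, ?_⟩
  set S := (F + 1) * B with hS
  have hsp : ∀ z ∈ spectrum ℂ (φ S), ‖z‖ < 1 := by
    have := aux_cayley (φ F) (φ B) (by rw [← map_one φ, ← map_sub, ← map_mul, hB1])
      (by rw [← map_one φ, ← map_sub, ← map_mul, hB2]) hF
    rw [← map_one φ, ← map_add, ← map_mul] at this
    exact this
  have ht : Tendsto (fun k : ℕ => φ S ^ k) atTop (nhds 0) := by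
    letI := Matrix.linftyOpNormedRing (n := Fin n) (α := ℂ)
    letI := Matrix.linftyOpNormedAlgebra (R := ℂ) (n := Fin n) (α := ℂ)
    haveI : CompleteSpace (Matrix (Fin n) (Fin n) ℂ) := FiniteDimensional.complete ℂ _
    exact aux_pow_tendsto (φ S) hsp
  have ht2 : Tendsto (fun k : ℕ => ∑ i, ∑ j, (S ^ k) i j ^ 2) atTop (nhds 0) := by
    have : (0 : ℝ) = ∑ i : Fin n, ∑ j : Fin n, (0 : ℝ) ^ 2 := by simp
    rw [this]
    refine tendsto_finsetSum _ fun i _ => tendsto_finsetSum _ fun j _ => Tendsto.pow ?_ 2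
    have h1 := tendsto_pi_nhds.1 (tendsto_pi_nhds.1 ht i) j
    have h2 := (Complex.continuous_re.tendsto _).comp h1
    refine h2.congr fun k => ?_
    simp only [Function.comp, ← map_pow]
    simp [φ]
  obtain ⟨N, hN, hN0⟩ := ((ht2.eventually_lt_const (show (0 : ℝ) < 1 / 2 by norm_num)).and
    (eventually_gt_atTop 0)).exists
  refine ⟨N, hN0, fun x => (aux_bound _ x).trans ?_⟩
  exact mul_le_mul_of_nonneg_right hN.le (Finset.sum_nonneg fun i _ => mul_self_nonneg _)

theorem aux_lyap {n : ℕ} (hn : 1 ≤ n) (F : Matrix (Fin n) (Fin n) ℝ) (hF : IsHurwitz F) :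
    ∃ (P : Matrix (Fin n) (Fin n) ℝ) (c C : ℝ), 0 < c ∧ 0 < C ∧ Pᵀ = P ∧
      (∀ x, x ⬝ᵥ x ≤ x ⬝ᵥ P *ᵥ x) ∧ (∀ x, x ⬝ᵥ P *ᵥ x ≤ C * (x ⬝ᵥ x)) ∧
      ∀ x, x ⬝ᵥ P *ᵥ (F *ᵥ x) ≤ - c * (x ⬝ᵥ x) := by
  obtain ⟨B, hB, N, hN, hle⟩ := aux_stein hn F hF
  set S := (F + 1) * B with hS
  have hnn : ∀ x : Fin n → ℝ, 0 ≤ x ⬝ᵥ x := fun x => Finset.sum_nonneg fun i _ => mul_self_nonneg _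
  let P := ∑ k ∈ Finset.range N, (S ^ k)ᵀ * S ^ k
  have hP : ∀ x, x ⬝ᵥ P *ᵥ x = ∑ k ∈ Finset.range N, (S ^ k *ᵥ x) ⬝ᵥ (S ^ k *ᵥ x) := by
    intro x
    simp only [P, Matrix.sum_mulVec, dotProduct_sum]
    refine Finset.sum_congr rfl fun k _ => ?_
    rw [← mulVec_mulVec, dotProduct_mulVec, vecMul_transpose]
  have hPt : Pᵀ = P := by
    simp [P, Matrix.transpose_sum, Matrix.transpose_mul]
  have hsymm : ∀ x y, x ⬝ᵥ P *ᵥ y = y ⬝ᵥ P *ᵥ x := by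
    intro x y
    rw [dotProduct_mulVec, ← mulVec_transpose, hPt, dotProduct_comm]
  have hstep : ∀ y, (S *ᵥ y) ⬝ᵥ P *ᵥ (S *ᵥ y) - y ⬝ᵥ P *ᵥ y ≤ - (1 / 2) * (y ⬝ᵥ y) := by
    intro y
    rw [hP, hP, ← Finset.sum_sub_distrib]
    have := Finset.sum_range_sub (fun k => (S ^ k *ᵥ y) ⬝ᵥ (S ^ k *ᵥ y)) N
    simp only [mulVec_mulVec, ← pow_succ]
    rw [this]
    simp only [pow_zero, one_mulVec]
    linarith [hle y]
  set b := ∑ i, ∑ j, B i j ^ 2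
  have hb : 0 ≤ b := Finset.sum_nonneg fun i _ => Finset.sum_nonneg fun j _ => sq_nonneg _
  set C := ∑ k ∈ Finset.range N, ∑ i, ∑ j, (S ^ k) i j ^ 2
  have hC : 0 ≤ C := Finset.sum_nonneg fun k _ =>
    Finset.sum_nonneg fun i _ => Finset.sum_nonneg fun j _ => sq_nonneg _
  refine ⟨P, 1 / (8 * (b + 1)), C + 1, by positivity, by positivity, hPt, ?_, ?_, ?_⟩
  · intro x
    rw [hP]
    have := Finset.single_le_sum (f := fun k => (S ^ k *ᵥ x) ⬝ᵥ (S ^ k *ᵥ x))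
      (fun k _ => hnn _) (Finset.mem_range.2 hN)
    simpa using this
  · intro x
    have : x ⬝ᵥ P *ᵥ x ≤ C * (x ⬝ᵥ x) := by
      rw [hP, Finset.sum_mul]
      exact Finset.sum_le_sum fun k _ => aux_bound _ x
    linarith [hnn x]
  · intro x
    set y := (F - 1) *ᵥ x with hy
    have hx : B *ᵥ y = x := by rw [hy, mulVec_mulVec, hB, one_mulVec]
    have hSy : S *ᵥ y = F *ᵥ x + x := by
      rw [hS, ← mulVec_mulVec, hx, add_mulVec, one_mulVec]
    have hy' : y = F *ᵥ x - x := by rw [hy, sub_mulVec, one_mulVec]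
    have h1 := hstep y
    have h2 := aux_bound B y
    rw [hx] at h2
    have h3 : (S *ᵥ y) ⬝ᵥ P *ᵥ (S *ᵥ y) - y ⬝ᵥ P *ᵥ y = 4 * (x ⬝ᵥ P *ᵥ (F *ᵥ x)) := by
      rw [hSy, hy']
      simp only [mulVec_add, mulVec_sub, add_dotProduct, sub_dotProduct, dotProduct_add,
        dotProduct_sub]
      rw [hsymm (F *ᵥ x) x]
      ring
    rw [h3] at h1
    have h4 : x ⬝ᵥ x ≤ (b + 1) * (y ⬝ᵥ y) := by linarith [hnn y]
    have h5 : 1 / (8 * (b + 1)) * (x ⬝ᵥ x) ≤ (1 / 8) * (y ⬝ᵥ y) := by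
      rw [div_mul_eq_mul_div, div_le_iff₀ (by positivity)]
      linarith
    linarith

theorem aux_decay (W W' : ℝ → ℝ) (δ : ℝ) (hδ : 0 < δ) (hW : ∀ t, HasDerivAt W (W' t) t)
    (h0 : ∀ t, 0 ≤ W t) (hle : ∀ t, W' t ≤ - δ * W t) : Tendsto W atTop (nhds 0) := by
  have hd : ∀ t, HasDerivAt (fun t => W t * Real.exp (δ * t))
      (W' t * Real.exp (δ * t) + W t * (Real.exp (δ * t) * (δ * 1))) t := fun t =>
    (hW t).mul (((hasDerivAt_id t).const_mul δ).exp)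
  have ha : Antitone (fun t => W t * Real.exp (δ * t)) := by
    apply antitone_of_hasDerivAt_nonpos hd
    intro t
    have := Real.exp_pos (δ * t)
    simp only [Pi.zero_apply]
    nlinarith [hle t]
  have hlim : Tendsto (fun t => W 0 * Real.exp (-(δ * t))) atTop (nhds 0) := by
    have h1 : Tendsto (fun t : ℝ => δ * t) atTop atTop := tendsto_id.const_mul_atTop hδ
    simpa using (Real.tendsto_exp_neg_atTop_nhds_zero.comp h1).const_mul (W 0)
  apply squeeze_zero' (Eventually.of_forall h0) _ hlim
  filter_upwards [eventually_ge_atTop 0] with t ht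
  have h1 := ha ht
  simp only [mul_zero, Real.exp_zero, mul_one] at h1
  rw [Real.exp_neg, ← div_eq_mul_inv, le_div_iff₀ (Real.exp_pos _)]
  exact h1

theorem aux_deriv {n : ℕ} (P : Matrix (Fin n) (Fin n) ℝ) (ξ : ℝ → Fin n → ℝ) (v : Fin n → ℝ)
    (t : ℝ) (h : HasDerivAt ξ v t) :
    HasDerivAt (fun t => ξ t ⬝ᵥ P *ᵥ ξ t) (v ⬝ᵥ P *ᵥ ξ t + ξ t ⬝ᵥ P *ᵥ v) t := by
  rw [hasDerivAt_pi] at h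
  simp only [dotProduct, mulVec, ← Finset.sum_add_distrib]
  exact HasDerivAt.fun_sum fun i _ =>
    (h i).mul (HasDerivAt.fun_sum fun j _ => (h j).const_mul (P i j))

/-- **High-gain stabilization.** If `F̃` is Hurwitz then there is `K*` such that for every
`K ≥ K*`, every solution of `ė = -K e + G̃ ξ̃`, `ξ̃̇ = F̃ ξ̃ + H̃ e` satisfies
`e(t) → 0` and `ξ̃(t) → 0` as `t → ∞`.  Here `G̃` is a `1 × n` matrix (a covector) and
`H̃` an `n × 1` matrix (a vector). -/
theorem high_gain_stability (n : ℕ) (hn : 1 ≤ n)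
    (Ftil : Matrix (Fin n) (Fin n) ℝ) (hF : IsHurwitz Ftil)
    (Gtil : Fin n → ℝ) (Htil : Fin n → ℝ) :
    ∃ Kstar : ℝ, ∀ K : ℝ, Kstar ≤ K →
      ∀ (e : ℝ → ℝ) (ξ : ℝ → Fin n → ℝ),
        (∀ t : ℝ, HasDerivAt e (-K * e t + Gtil ⬝ᵥ ξ t) t) →
        (∀ t : ℝ, HasDerivAt ξ (Ftil.mulVec (ξ t) + e t • Htil) t) →
        Tendsto e atTop (nhds 0) ∧ Tendsto ξ atTop (nhds 0) := by
  obtain ⟨P, c, C, hc, hC, hPt, hlow, hup, hneg⟩ := aux_lyap hn Ftil hF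
  have hnn : ∀ x : Fin n → ℝ, 0 ≤ x ⬝ᵥ x := fun x => Finset.sum_nonneg fun i _ => mul_self_nonneg _
  have hsymm : ∀ x y, x ⬝ᵥ P *ᵥ y = y ⬝ᵥ P *ᵥ x := by
    intro x y
    rw [dotProduct_mulVec, ← mulVec_transpose, hPt, dotProduct_comm]
  set b := Gtil + P *ᵥ Htil with hb
  refine ⟨(b ⬝ᵥ b) / c + 1, fun K hK e ξ he hξ => ?_⟩
  set δ := min 1 (c / C) with hδ
  have hδ0 : 0 < δ := lt_min one_pos (by positivity)
  have hδ1 : δ ≤ 1 := min_le_left _ _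
  have hδ2 : δ * C ≤ c := by
    rw [← le_div_iff₀ hC]; exact min_le_right _ _
  have hW0 : ∀ t, 0 ≤ ξ t ⬝ᵥ P *ᵥ ξ t := fun t => (hnn _).trans (hlow _)
  have key : Tendsto (fun t => e t ^ 2 + ξ t ⬝ᵥ P *ᵥ ξ t) atTop (nhds 0) := by
    refine aux_decay _ _ δ hδ0
      (fun t => ((he t).fun_pow 2).add (aux_deriv P ξ _ t (hξ t))) ?_ ?_
    · intro t
      have := hW0 t
      positivity
    · intro t
      rw [hsymm (Ftil *ᵥ ξ t + e t • Htil) (ξ t)]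
      simp only [mulVec_add, mulVec_smul, dotProduct_add, dotProduct_smul, smul_eq_mul]
      have h1 := hneg (ξ t)
      have h2 := hup (ξ t)
      have h3 : Gtil ⬝ᵥ ξ t + ξ t ⬝ᵥ P *ᵥ Htil = b ⬝ᵥ ξ t := by
        rw [hb, add_dotProduct, dotProduct_comm (P *ᵥ Htil)]
      have h4 := hnn (e t • b - c • ξ t)
      simp only [dotProduct_sub, sub_dotProduct, dotProduct_smul, smul_dotProduct,
        smul_eq_mul, dotProduct_comm (ξ t) b] at h4
      have h5 : 2 * (e t * (b ⬝ᵥ ξ t)) ≤ (b ⬝ᵥ b) / c * e t ^ 2 + c * (ξ t ⬝ᵥ ξ t) := by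
        have : (b ⬝ᵥ b) / c * e t ^ 2 + c * (ξ t ⬝ᵥ ξ t) - 2 * (e t * (b ⬝ᵥ ξ t))
          = (e t * (e t * (b ⬝ᵥ b)) - c * (e t * (b ⬝ᵥ ξ t)) -
              (e t * (c * (b ⬝ᵥ ξ t)) - c * (c * (ξ t ⬝ᵥ ξ t)))) / c := by
          field_simp
          ring
        have h6 : 0 ≤ (e t * (e t * (b ⬝ᵥ b)) - c * (e t * (b ⬝ᵥ ξ t)) -
              (e t * (c * (b ⬝ᵥ ξ t)) - c * (c * (ξ t ⬝ᵥ ξ t)))) / c := by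
          apply div_nonneg _ hc.le
          linarith
        linarith
      have hbc : 0 ≤ (b ⬝ᵥ b) / c := div_nonneg (hnn b) hc.le
      have h7 : ((b ⬝ᵥ b) / c + 1) * e t ^ 2 ≤ K * e t ^ 2 :=
        mul_le_mul_of_nonneg_right hK (sq_nonneg _)
      have h8 : δ * e t ^ 2 ≤ 1 * e t ^ 2 := mul_le_mul_of_nonneg_right hδ1 (sq_nonneg _)
      have h9 : δ * (ξ t ⬝ᵥ P *ᵥ ξ t) ≤ δ * (C * (ξ t ⬝ᵥ ξ t)) :=
        mul_le_mul_of_nonneg_left h2 hδ0.le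
      have h10 : δ * C * (ξ t ⬝ᵥ ξ t) ≤ c * (ξ t ⬝ᵥ ξ t) :=
        mul_le_mul_of_nonneg_right hδ2 (hnn _)
      have h11 : 0 ≤ (b ⬝ᵥ b) / c * e t ^ 2 := mul_nonneg hbc (sq_nonneg _)
      rw [← h3] at h5
      push_cast
      nlinarith [h1, h5, h7, h8, h9, h10, h11, sq_nonneg (e t)]
  have hsq : ∀ f : ℝ → ℝ, (∀ t, f t ^ 2 ≤ e t ^ 2 + ξ t ⬝ᵥ P *ᵥ ξ t) →
      Tendsto f atTop (nhds 0) := by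
    intro f hf
    have h1 : Tendsto (fun t => f t ^ 2) atTop (nhds 0) :=
      squeeze_zero (fun t => sq_nonneg _) hf key
    have h2 := h1.sqrt
    simp only [Real.sqrt_sq_eq_abs, Real.sqrt_zero] at h2
    exact (tendsto_zero_iff_abs_tendsto_zero f).2 h2
  refine ⟨hsq e fun t => by linarith [hW0 t], tendsto_pi_nhds.2 fun i => hsq _ fun t => ?_⟩
  have h1 : ξ t i * ξ t i ≤ ξ t ⬝ᵥ ξ t :=
    Finset.single_le_sum (f := fun i => ξ t i * ξ t i) (fun i _ => mul_self_nonneg _)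
      (Finset.mem_univ i)
  nlinarith [hlow (ξ t), sq_nonneg (e t)]
end

section
/- Let q ≥ 1, let F be a real q×q matrix, G a real q×1 matrix, Ψ, Ψ̂ real 1×q matrix-valued functions, K̃, K_e, K_x, α_x ∈ ℝ, and let (e, ŵ, x̃, Ψ̂, w) be differentiable functions solving the closed-loop equations ė = −(K̃ + K_e) e + α_x x̃ − Ψ̂ ŵ + Ψ w, ŵ̇ = (F + G Ψ̂) ŵ + G K_e e, ẋ̃ = −K_x x̃, ẇ = (F + G Ψ) w, where Ψ is a constant 1×q matrix. Define w̃ := ŵ − w + G e and Ψ̃ := Ψ̂ − Ψ. Then for all t: ė = −K e + α_x x̃ − Ψ w̃ − Ψ̃ ŵ and w̃̇ = F w̃ − H e + α_x G x̃, where K := K̃ + K_e − Ψ G and H := F G + G K̃. -/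
open Matrix

/-- **Error coordinates for the closed loop.** For the closed-loop system
`ė = -(K̃ + K_e) e + αₓ x̃ - Ψ̂ ŵ + Ψ w`, `ŵ̇ = (F + G Ψ̂) ŵ + G K_e e`, `x̃̇ = -Kₓ x̃`,
`Ψ̂̇ = e ŵᵀ`, `ẇ = (F + G Ψ) w` (with `G` a column vector and `Ψ, Ψ̂` row vectors), the error
variables `w̃ := ŵ - w + G e` and `Ψ̃ := Ψ̂ - Ψ` satisfy
`ė = -K e + αₓ x̃ - Ψ w̃ - Ψ̃ ŵ` and `w̃̇ = F w̃ - H e + αₓ G x̃`,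
where `K := K̃ + K_e - Ψ G` and `H := F G + G K̃`. -/
theorem closed_loop_error_coordinates (q : ℕ) (hq : 1 ≤ q)
    (F : Matrix (Fin q) (Fin q) ℝ) (G : Fin q → ℝ) (Ψ : Fin q → ℝ)
    (Ktilde Ke Kx αx : ℝ)
    (e : ℝ → ℝ) (what w : ℝ → Fin q → ℝ) (xtil : ℝ → ℝ) (Psihat : ℝ → Fin q → ℝ)
    (he : ∀ t : ℝ, HasDerivAt e
      (-(Ktilde + Ke) * e t + αx * xtil t - Psihat t ⬝ᵥ what t + Ψ ⬝ᵥ w t) t)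
    (hwhat : ∀ t : ℝ, HasDerivAt what
      (F.mulVec (what t) + (Psihat t ⬝ᵥ what t) • G + (Ke * e t) • G) t)
    (hxtil : ∀ t : ℝ, HasDerivAt xtil (-Kx * xtil t) t)
    (hPsihat : ∀ t : ℝ, HasDerivAt Psihat (e t • what t) t)
    (hw : ∀ t : ℝ, HasDerivAt w (F.mulVec (w t) + (Ψ ⬝ᵥ w t) • G) t)
    (wtil : ℝ → Fin q → ℝ) (hwtil : wtil = fun t => what t - w t + e t • G)
    (Psitil : ℝ → Fin q → ℝ) (hPsitil : Psitil = fun t => Psihat t - Ψ)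
    (K : ℝ) (hK : K = Ktilde + Ke - Ψ ⬝ᵥ G)
    (H : Fin q → ℝ) (hH : H = F.mulVec G + Ktilde • G) :
    (∀ t : ℝ, HasDerivAt e
      (-K * e t + αx * xtil t - Ψ ⬝ᵥ wtil t - Psitil t ⬝ᵥ what t) t) ∧
    (∀ t : ℝ, HasDerivAt wtil
      (F.mulVec (wtil t) - e t • H + (αx * xtil t) • G) t) := by
  subst hwtil hPsitil hK hH
  refine ⟨fun t => ?_, fun t => ?_⟩
  · convert he t using 1
    simp only [dotProduct_add, dotProduct_sub, sub_dotProduct, dotProduct_smul, smul_eq_mul]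
    ring
  · refine (((hwhat t).sub (hw t)).add ((he t).smul_const G)).congr_deriv ?_
    simp only [Matrix.mulVec_add, Matrix.mulVec_sub, Matrix.mulVec_smul]
    module
end

section
/- Let q ≥ 1 and n = q + 1. Let F̃ be a real n×n matrix, G̃ a real 1×n matrix, H̃ a real n×1 matrix, K ∈ ℝ, and let P be a symmetric positive definite n×n matrix with P F̃ + F̃ᵀ P = −γ I, γ > 0, such that 2Kγ > ‖P H̃ + G̃ᵀ‖². Let (e, ξ̃, Ψ̃) be a solution of ė = −K e + G̃ ξ̃ − Ψ̃ ŵ, ξ̃̇ = F̃ ξ̃ + H̃ e, Ψ̃̇ = e ŵᵀ, where ŵ : ℝ → ℝ^q is the continuous function determined along the solution. Then V_Ψ(t) = e(t)² + ξ̃(t)ᵀ P ξ̃(t) + Ψ̃(t)Ψ̃(t)ᵀ is nonincreasing in t; consequently e, ξ̃, and Ψ̃ remain bounded on [0, ∞), and ∫₀^∞ (e(t)² + ‖ξ̃(t)‖²) dt < ∞. -/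
open Matrix

theorem aux_dot_deriv {m : ℕ} {f g : ℝ → Fin m → ℝ} {f' g' : Fin m → ℝ} {t : ℝ}
    (hf : HasDerivAt f f' t) (hg : HasDerivAt g g' t) :
    HasDerivAt (fun s => f s ⬝ᵥ g s) (f' ⬝ᵥ g t + f t ⬝ᵥ g') t := by
  rw [hasDerivAt_pi] at hf hg
  have h := HasDerivAt.fun_sum (u := Finset.univ) (fun i _ => (hf i).mul (hg i))
  simp only [dotProduct, ← Finset.sum_add_distrib]
  exact h

theorem aux_mulVec_deriv {m : ℕ} (P : Matrix (Fin m) (Fin m) ℝ) {f : ℝ → Fin m → ℝ}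
    {f' : Fin m → ℝ} {t : ℝ} (hf : HasDerivAt f f' t) :
    HasDerivAt (fun s => P.mulVec (f s)) (P.mulVec f') t := by
  rw [hasDerivAt_pi] at hf ⊢
  intro i
  exact HasDerivAt.fun_sum (u := Finset.univ) (fun j _ => (hf j).const_mul (P i j))

theorem aux_coercive {n : ℕ} (hn : 0 < n) (P : Matrix (Fin n) (Fin n) ℝ) (hP : P.PosDef) :
    ∃ D : ℝ, 0 ≤ D ∧ ∀ x : Fin n → ℝ, x ⬝ᵥ x ≤ D * (x ⬝ᵥ P.mulVec x) := by
  haveI : Nonempty (Fin n) := ⟨⟨0, hn⟩⟩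
  have hpos : ∀ x : Fin n → ℝ, x ≠ 0 → 0 < x ⬝ᵥ P.mulVec x := by
    intro x hx
    simpa using hP.dotProduct_mulVec_pos hx
  have hcont : ContinuousOn (fun x : Fin n → ℝ => (x ⬝ᵥ x) / (x ⬝ᵥ P.mulVec x))
      (Metric.sphere 0 1) := by
    apply ContinuousOn.div
    · exact (continuous_id.dotProduct continuous_id).continuousOn
    · exact (continuous_id.dotProduct
        (continuous_const.matrix_mulVec continuous_id)).continuousOn
    · intro x hx
      exact (hpos x (ne_zero_of_mem_unit_sphere ⟨x, hx⟩)).ne'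
  obtain ⟨D, hD⟩ := (isCompact_sphere (0 : Fin n → ℝ) 1).bddAbove_image hcont
  refine ⟨max D 0, le_max_right _ _, fun x => ?_⟩
  by_cases hx : x = 0
  · simp [hx]
  have hnx : ‖x‖ ≠ 0 := norm_ne_zero_iff.mpr hx
  have h1 := hD (Set.mem_image_of_mem _ (show ‖x‖⁻¹ • x ∈ Metric.sphere (0 : Fin n → ℝ) 1 by
    simp [norm_smul, hnx]))
  have hp := hpos x hx
  simp only [mulVec_smul, smul_dotProduct, dotProduct_smul, smul_eq_mul] at h1
  rw [mul_div_mul_left _ _ (inv_ne_zero hnx), mul_div_mul_left _ _ (inv_ne_zero hnx),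
    div_le_iff₀ hp] at h1
  exact h1.trans (mul_le_mul_of_nonneg_right (le_max_left _ _) hp.le)

theorem aux_quad {n : ℕ} (K γ : ℝ) (hγ : 0 < γ) (b : Fin n → ℝ)
    (h : 2 * K * γ > ∑ i, b i ^ 2) :
    ∃ c : ℝ, 0 < c ∧ ∀ (a : ℝ) (x : Fin n → ℝ),
      c * (a ^ 2 + x ⬝ᵥ x) ≤ 2 * K * a ^ 2 - 2 * a * (b ⬝ᵥ x) + γ * (x ⬝ᵥ x) := by
  set s := ∑ i, b i ^ 2 with hs
  have hs0 : 0 ≤ s := Finset.sum_nonneg fun i _ => sq_nonneg _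
  have hK : 0 < K := by
    by_contra hK
    nlinarith
  have hc0 : 0 < (2 * K * γ - s) / (2 * K + γ) := div_pos (by linarith) (by linarith)
  have hcm : (2 * K * γ - s) / (2 * K + γ) * (2 * K + γ) = 2 * K * γ - s :=
    div_mul_cancel₀ _ (by linarith)
  set c := (2 * K * γ - s) / (2 * K + γ)
  refine ⟨c, hc0, fun a x => ?_⟩
  have hm : 0 < γ - c := by
    by_contra hh
    nlinarith
  have hsum : ∑ i, (a * b i - (γ - c) * x i) ^ 2
      = s * a ^ 2 - 2 * a * (γ - c) * (b ⬝ᵥ x) + (γ - c) ^ 2 * (x ⬝ᵥ x) := by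
    simp only [hs, dotProduct, Finset.sum_mul, Finset.mul_sum, ← Finset.sum_add_distrib,
      ← Finset.sum_sub_distrib]
    exact Finset.sum_congr rfl fun i _ => by ring
  have hnn : 0 ≤ ∑ i, (a * b i - (γ - c) * x i) ^ 2 := Finset.sum_nonneg fun i _ => sq_nonneg _
  rw [hsum] at hnn
  have hdet : (2 * K - c) * (γ - c) = s + c ^ 2 := by linear_combination -hcm
  have : 0 ≤ (γ - c) * ((2 * K - c) * a ^ 2 - 2 * a * (b ⬝ᵥ x) + (γ - c) * (x ⬝ᵥ x)) := by
    have e1 : (γ - c) * ((2 * K - c) * a ^ 2 - 2 * a * (b ⬝ᵥ x) + (γ - c) * (x ⬝ᵥ x))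
      = (s * a ^ 2 - 2 * a * (γ - c) * (b ⬝ᵥ x) + (γ - c) ^ 2 * (x ⬝ᵥ x)) + (c * a) ^ 2 := by
      linear_combination a ^ 2 * hdet
    rw [e1]
    positivity
  have := nonneg_of_mul_nonneg_right this hm
  linarith

/-- **Boundedness and square integrability.** Under the closed-loop error dynamics with the
adaptation law, if `P F̃ + F̃ᵀ P = -γ I` with `P` symmetric positive definite and
`2 K γ > ‖P H̃ + G̃ᵀ‖²`, then `V_Ψ(t) = e(t)² + ξ̃(t)ᵀ P ξ̃(t) + Ψ̃(t) Ψ̃(t)ᵀ` is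
nonincreasing; consequently `e`, `ξ̃`, `Ψ̃` remain bounded on `[0, ∞)` and
`∫₀^∞ (e² + ‖ξ̃‖²) < ∞`. -/
theorem lyapunov_boundedness_and_integrability (q n : ℕ) (hq : 1 ≤ q) (hn : n = q + 1)
    (K γ : ℝ) (hγ : 0 < γ)
    (Ftil : Matrix (Fin n) (Fin n) ℝ) (Gtil Htil : Fin n → ℝ)
    (P : Matrix (Fin n) (Fin n) ℝ) (hPsymm : P.IsSymm) (hPpos : P.PosDef)
    (hLyap : P * Ftil + Ftil.transpose * P = -γ • (1 : Matrix (Fin n) (Fin n) ℝ))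
    (hgain : 2 * K * γ > ∑ i, (P.mulVec Htil i + Gtil i) ^ 2)
    (e : ℝ → ℝ) (ξ : ℝ → Fin n → ℝ) (Psitil what : ℝ → Fin q → ℝ)
    (hwhat : Continuous what)
    (he : ∀ t : ℝ, HasDerivAt e (-K * e t + Gtil ⬝ᵥ ξ t - Psitil t ⬝ᵥ what t) t)
    (hξ : ∀ t : ℝ, HasDerivAt ξ (Ftil.mulVec (ξ t) + e t • Htil) t)
    (hPsitil : ∀ t : ℝ, HasDerivAt Psitil (e t • what t) t)
    (V : ℝ → ℝ)
    (hV : V = fun t => e t ^ 2 + ξ t ⬝ᵥ P.mulVec (ξ t) + Psitil t ⬝ᵥ Psitil t) :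
    Antitone V ∧
      (∃ C : ℝ, ∀ t : ℝ, 0 ≤ t →
        e t ^ 2 ≤ C ∧ ξ t ⬝ᵥ ξ t ≤ C ∧ Psitil t ⬝ᵥ Psitil t ≤ C) ∧
      MeasureTheory.IntegrableOn (fun t => e t ^ 2 + ξ t ⬝ᵥ ξ t) (Set.Ici 0) := by
  obtain ⟨c, hc, hquad⟩ := aux_quad K γ hγ (fun i => P.mulVec Htil i + Gtil i) hgain
  obtain ⟨D, hD0, hD⟩ := aux_coercive (by omega) P hPpos
  have hsym : ∀ x y : Fin n → ℝ, x ⬝ᵥ P.mulVec y = P.mulVec x ⬝ᵥ y := by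
    intro x y
    rw [dotProduct_mulVec, ← mulVec_transpose, hPsymm.eq]
  have hb : ∀ x : Fin n → ℝ, (fun i => P.mulVec Htil i + Gtil i) ⬝ᵥ x
      = P.mulVec Htil ⬝ᵥ x + Gtil ⬝ᵥ x := fun x => add_dotProduct (P.mulVec Htil) Gtil x
  have hL : ∀ x : Fin n → ℝ, 2 * (x ⬝ᵥ P.mulVec (Ftil.mulVec x)) = -γ * (x ⬝ᵥ x) := by
    intro x
    have h1 : x ⬝ᵥ (P * Ftil + Ftil.transpose * P).mulVec x = -γ * (x ⬝ᵥ x) := by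
      rw [hLyap, smul_mulVec, one_mulVec, dotProduct_smul, smul_eq_mul]
    rw [add_mulVec, dotProduct_add, ← mulVec_mulVec, ← mulVec_mulVec,
      dotProduct_mulVec x Ftil.transpose, vecMul_transpose,
      dotProduct_comm (Ftil.mulVec x), ← hsym] at h1
    linarith
  set V' : ℝ → ℝ := fun t => -(2 * K * e t ^ 2
    - 2 * e t * ((fun i => P.mulVec Htil i + Gtil i) ⬝ᵥ ξ t) + γ * (ξ t ⬝ᵥ ξ t)) with hV'
  have hder : ∀ t, HasDerivAt V (V' t) t := by
    intro t
    rw [hV]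
    have h := (((he t).pow 2).add (aux_dot_deriv (hξ t) (aux_mulVec_deriv P (hξ t)))).add
      (aux_dot_deriv (hPsitil t) (hPsitil t))
    refine h.congr_deriv ?_
    rw [hsym (Ftil.mulVec (ξ t) + e t • Htil), dotProduct_comm (P.mulVec _) (ξ t)]
    simp only [hV', hb, mulVec_add, mulVec_smul, dotProduct_add, dotProduct_smul,
      smul_dotProduct, smul_eq_mul, dotProduct_comm (what t), dotProduct_comm (P.mulVec Htil)]
    have := hL (ξ t)
    push_cast
    linear_combination this
  have hnn : ∀ {m : ℕ} (x : Fin m → ℝ), 0 ≤ x ⬝ᵥ x := fun x =>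
    Finset.sum_nonneg fun i _ => mul_self_nonneg _
  have hPnn : ∀ x : Fin n → ℝ, 0 ≤ x ⬝ᵥ P.mulVec x := fun x => by
    simpa using hPpos.posSemidef.dotProduct_mulVec_nonneg x
  have hV'le : ∀ t, c * (e t ^ 2 + ξ t ⬝ᵥ ξ t) ≤ -V' t := by
    intro t
    have := hquad (e t) (ξ t)
    simp only [hV', neg_neg]
    exact this
  have hV'0 : ∀ t, V' t ≤ 0 := by
    intro t
    have h1 := hV'le t
    have h2 := mul_nonneg hc.le (add_nonneg (sq_nonneg (e t)) (hnn (ξ t)))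
    linarith
  have hanti : Antitone V := antitone_of_hasDerivAt_nonpos hder hV'0
  have hV0 : ∀ t, 0 ≤ V t := by
    intro t
    rw [hV]
    have := hPnn (ξ t)
    have := hnn (Psitil t)
    positivity
  refine ⟨hanti, ⟨max (V 0) (D * V 0), fun t ht => ?_⟩, ?_⟩
  · have h1 := hanti ht
    have hVt : V t = e t ^ 2 + ξ t ⬝ᵥ P.mulVec (ξ t) + Psitil t ⬝ᵥ Psitil t := by rw [hV]
    have h2 := hPnn (ξ t)
    have h3 := hnn (Psitil t)
    have h4 := sq_nonneg (e t)
    refine ⟨le_max_of_le_left (by linarith), le_max_of_le_right ?_,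
      le_max_of_le_left (by linarith)⟩
    exact (hD (ξ t)).trans (mul_le_mul_of_nonneg_left (by linarith) hD0)
  · have hlim := tendsto_atTop_ciInf hanti ⟨0, by rintro _ ⟨t, rfl⟩; exact hV0 t⟩
    have hint : MeasureTheory.IntegrableOn V' (Set.Ioi 0) :=
      MeasureTheory.integrableOn_Ioi_deriv_of_nonpos' (fun t _ => hder t)
        (fun t _ => hV'0 t) hlim
    rw [integrableOn_Ici_iff_integrableOn_Ioi]
    have hec : Continuous e := continuous_iff_continuousAt.2 fun t => (he t).continuousAt
    have hxc : Continuous ξ := continuous_iff_continuousAt.2 fun t => (hξ t).continuousAt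
    refine MeasureTheory.Integrable.mono' (hint.neg.const_mul c⁻¹)
      ((hec.pow 2).add (hxc.dotProduct hxc)).aestronglyMeasurable
      (Filter.Eventually.of_forall fun t => ?_)
    rw [Real.norm_of_nonneg (add_nonneg (sq_nonneg (e t)) (hnn (ξ t)))]
    have := hV'le t
    simp only [Pi.neg_apply]
    rw [inv_mul_eq_div, le_div_iff₀ hc]
    linarith
end

section
/- Let q ≥ 1, let 𝒫 be a compact subset of ℝ × ℝ^{1×q}, let F be a real q×q Hurwitz matrix, G a real q×1 matrix, K_x > 0, and α_x ∈ ℝ. Then there exists K_e* > 0 such that for every K_e ≥ K_e*, every (K̃, Ψ) ∈ 𝒫, and every solution (e, ŵ, x̃, Ψ̂, w) : [0, ∞) → ℝ × ℝ^q × ℝ × ℝ^{1×q} × ℝ^q of the closed-loop system ė = −(K̃ + K_e) e + α_x x̃ − Ψ̂ ŵ + Ψ w, ŵ̇ = (F + G Ψ̂) ŵ + G K_e e, ẋ̃ = −K_x x̃, Ψ̂̇ = e ŵᵀ, ẇ = (F + G Ψ) w, with arbitrary initial conditions, the retinal error satisfies e(t) → 0 as t → ∞. -/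
open Matrix Filter

lemma growth_le {f f' : ℝ → ℝ} (hf : ∀ t ∈ Set.Ici (0:ℝ), HasDerivWithinAt f (f' t) (Set.Ici 0) t)
    {a b c : ℝ} (ha : 0 ≤ a) (hab : a ≤ b) (h : ∀ t ∈ Set.Icc a b, f' t ≤ c) :
    f b - f a ≤ c * (b - a) := by
  have hsub : Set.Icc a b ⊆ Set.Ici (0:ℝ) := fun t ht => ha.trans ht.1
  have : AntitoneOn (fun t => f t - c * t) (Set.Icc a b) := by
    apply antitoneOn_of_hasDerivWithinAt_nonpos (f' := fun t => f' t - c) (convex_Icc a b)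
    · intro t ht
      exact (((hf t (hsub ht)).continuousWithinAt).mono hsub).sub (by fun_prop)
    · intro t ht
      have ht' := interior_subset ht
      have h1 := (hf t (hsub ht')).mono (interior_subset.trans hsub)
      have h2 : HasDerivWithinAt (fun t => c * t) c (interior (Set.Icc a b)) t := by
        simpa using ((hasDerivAt_id t).const_mul c).hasDerivWithinAt
      exact h1.sub h2
    · intro t ht
      have := h t (interior_subset ht)
      linarith
  have := this (Set.left_mem_Icc.2 hab) (Set.right_mem_Icc.2 hab) hab
  simp only at this
  linarith

lemma growth_ge {f f' : ℝ → ℝ} (hf : ∀ t ∈ Set.Ici (0:ℝ), HasDerivWithinAt f (f' t) (Set.Ici 0) t)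
    {a b c : ℝ} (ha : 0 ≤ a) (hab : a ≤ b) (h : ∀ t ∈ Set.Icc a b, c ≤ f' t) :
    c * (b - a) ≤ f b - f a := by
  have := growth_le (f := fun t => - f t) (f' := fun t => - f' t) (c := -c)
    (fun t ht => (hf t ht).neg) ha hab (fun t ht => by have := h t ht; linarith)
  linarith

lemma cauchy_of_antitone {V : ℝ → ℝ} (hV : ∀ a b, 0 ≤ a → a ≤ b → V b ≤ V a)
    (h0 : ∀ t, 0 ≤ t → 0 ≤ V t) {μ : ℝ} (hμ : 0 < μ) :
    ∃ T, 0 ≤ T ∧ ∀ a b, T ≤ a → a ≤ b → V a - V b < μ := by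
  have hbdd : BddBelow (V '' Set.Ici 0) := ⟨0, by rintro _ ⟨t, ht, rfl⟩; exact h0 t ht⟩
  have hne : (V '' Set.Ici 0).Nonempty := ⟨_, 0, by simp, rfl⟩
  obtain ⟨_, ⟨T, hT, rfl⟩, hlt⟩ := exists_lt_of_csInf_lt hne (lt_add_of_pos_right (sInf (V '' Set.Ici 0)) hμ)
  refine ⟨T, hT, fun a b hTa hab => ?_⟩
  have h1 := hV T a hT hTa
  have h2 : sInf (V '' Set.Ici 0) ≤ V b := csInf_le hbdd ⟨b, le_trans hT (hTa.trans hab), rfl⟩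
  linarith

lemma scalar_core {e p l V g m η V' : ℝ → ℝ} {C : ℝ} (hC : 1 ≤ C)
    (he : ∀ t ∈ Set.Ici (0:ℝ), HasDerivWithinAt e (g t - p t * Real.exp (l t)) (Set.Ici 0) t)
    (hp : ∀ t ∈ Set.Ici (0:ℝ), HasDerivWithinAt p (e t * Real.exp (l t) + m t) (Set.Ici 0) t)
    (hl : ∀ t ∈ Set.Ici (0:ℝ), HasDerivWithinAt l (η t) (Set.Ici 0) t)
    (hV : ∀ t ∈ Set.Ici (0:ℝ), HasDerivWithinAt V (V' t) (Set.Ici 0) t)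
    (bV : ∀ t, 0 ≤ t → V' t ≤ -(e t)^2) (b0 : ∀ t, 0 ≤ t → 0 ≤ V t)
    (be : ∀ t, 0 ≤ t → |e t| ≤ C) (bp : ∀ t, 0 ≤ t → |p t| ≤ C) (bg : ∀ t, 0 ≤ t → |g t| ≤ C)
    (bm : ∀ t, 0 ≤ t → |m t| ≤ C) (bη : ∀ t, 0 ≤ t → |η t| ≤ C) :
    Tendsto e atTop (nhds 0) := by
  have hVanti : ∀ a b, 0 ≤ a → a ≤ b → V b ≤ V a := by
    intro a b ha hab
    have := growth_le hV (c := 0) ha hab (fun t ht => by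
      have := bV t (ha.trans ht.1); nlinarith [sq_nonneg (e t)])
    linarith
  have hC0 : 0 < C := by linarith
  have mulb : ∀ {a b A B : ℝ}, |a| ≤ A → |b| ≤ B → |a * b| ≤ A * B := by
    intro a b A B h1 h2
    rw [abs_mul]; exact mul_le_mul h1 h2 (abs_nonneg _) ((abs_nonneg _).trans h1)
  -- main claim
  have main : ∀ ε > 0, ∃ T, 0 ≤ T ∧ ∀ t, T ≤ t → (e t)^2 ≤ ε := by
    intro ε hε
    -- Q Lipschitz
    set Q : ℝ → ℝ := fun t => e t ^ 2 + p t ^ 2 with hQ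
    have dQ : ∀ t ∈ Set.Ici (0:ℝ), HasDerivWithinAt Q (2 * (e t * g t) + 2 * (p t * m t)) (Set.Ici 0) t := by
      intro t ht
      have h := ((he t ht).pow 2).add ((hp t ht).pow 2)
      refine h.congr_deriv ?_
      norm_num; ring
    have Qlip : ∀ a b, 0 ≤ a → a ≤ b → Q a - 4 * C^2 * (b - a) ≤ Q b := by
      intro a b ha hab
      have := growth_ge dQ (c := -(4*C^2)) ha hab (fun t ht => by
        have h0 := ha.trans ht.1
        have h1 := (abs_le.1 (mulb (be t h0) (bg t h0))).1
        have h2 := (abs_le.1 (mulb (bp t h0) (bm t h0))).1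
        nlinarith)
      linarith
    have llow : ∀ a b, 0 ≤ a → a ≤ b → l a - C * (b - a) ≤ l b := by
      intro a b ha hab
      have := growth_ge hl (c := -C) ha hab (fun t ht => (abs_le.1 (bη t (ha.trans ht.1))).1)
      linarith
    have lup : ∀ a b, 0 ≤ a → a ≤ b → l b ≤ l a + C * (b - a) := by
      intro a b ha hab
      have := growth_le hl (c := C) ha hab (fun t ht => (abs_le.1 (bη t (ha.trans ht.1))).2)
      linarith
    -- N
    set N : ℝ → ℝ := fun t => e t * p t * Real.exp (-l t) with hN
    have dM : ∀ t ∈ Set.Ici (0:ℝ), HasDerivWithinAt (fun t => 2 * V t + N t)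
        (2 * V' t + (e t ^ 2 - p t ^2 + Real.exp (-l t) * (g t * p t + e t * m t - e t * p t * η t))) (Set.Ici 0) t := by
      intro t ht
      have h := ((hV t ht).const_mul 2).add (((he t ht).mul (hp t ht)).mul ((hl t ht).neg.exp))
      refine h.congr_deriv ?_
      have hx : Real.exp (l t) * Real.exp (-l t) = 1 := by rw [← Real.exp_add]; simp
      simp only [Pi.mul_apply, Pi.neg_apply]
      linear_combination (e t ^2 - p t ^2) * hx
    set K : ℝ := 2 * C^2 + C^3 with hK
    have hKpos : 0 < K := by positivity
    set δ : ℝ := min 1 (ε / (8 * C^2)) with hδ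
    have hδ0 : 0 < δ := by positivity
    have hδ1 : δ ≤ 1 := min_le_left _ _
    have hδ2 : 4 * C^2 * δ ≤ ε/2 := by
      have : δ ≤ ε / (8 * C^2) := min_le_right _ _
      rw [le_div_iff₀ (by positivity)] at this
      linarith
    set κ : ℝ := min (ε / (4 * K)) (δ * ε / (16 * C^2)) with hκ
    have hκ0 : 0 < κ := by positivity
    have hκ1 : K * κ ≤ ε/4 := by
      have : κ ≤ _ := min_le_left _ _
      rw [le_div_iff₀ (by positivity)] at this
      linarith
    have hκ2 : 2 * C^2 * κ ≤ δ * ε/8 := by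
      have : κ ≤ _ := min_le_right _ _
      rw [le_div_iff₀ (by positivity)] at this
      linarith
    set Λ : ℝ := C - Real.log κ with hΛ
    set E : ℝ := C + C * Real.exp (Λ + C) with hE
    have hE0 : 0 < E := by positivity
    set δ' : ℝ := min 1 (ε / (4 * C * E)) with hδ'
    have hδ'0 : 0 < δ' := by positivity
    have hδ'1 : δ' ≤ 1 := min_le_left _ _
    have hδ'2 : 2 * C * E * δ' ≤ ε/2 := by
      have : δ' ≤ ε / (4 * C * E) := min_le_right _ _
      rw [le_div_iff₀ (by positivity)] at this
      linarith
    obtain ⟨T, hT0, hT⟩ := cauchy_of_antitone hVanti b0 (μ := min (δ * ε/16) (δ' * ε / 2)) (by positivity)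
    refine ⟨T, hT0, fun t ht => ?_⟩
    by_contra! hcon
    have ht0 : 0 ≤ t := hT0.trans ht
    rcases le_total Λ (l t) with hcase | hcase
    · have hy : ∀ τ ∈ Set.Icc t (t + δ), Real.exp (-l τ) ≤ κ := by
        intro τ hτ
        have h1 := llow t τ ht0 hτ.1
        have h2 : C * (τ - t) ≤ C * 1 := by
          apply mul_le_mul_of_nonneg_left _ hC0.le; linarith [hτ.2]
        rw [← Real.exp_log hκ0]
        apply Real.exp_le_exp.2
        linarith
      have h1 := growth_le dM (c := -(ε/4)) ht0 (by linarith : t ≤ t + δ) (fun τ hτ => by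
        have h0 := ht0.trans hτ.1
        have q1 := Qlip t τ ht0 hτ.1
        have q2 : 4 * C^2 * (τ - t) ≤ 4 * C^2 * δ := by
          apply mul_le_mul_of_nonneg_left _ (by positivity); linarith [hτ.2]
        have q3 : ε < Q t := by simp only [hQ]; nlinarith [sq_nonneg (p t)]
        have q4 : ε/2 ≤ e τ ^2 + p τ ^2 := by simp only [hQ] at q1 q3 ⊢; linarith
        have q5 := bV τ h0
        have q6 : g τ * p τ + e τ * m τ - e τ * p τ * η τ ≤ K := by
          have a1 := (abs_le.1 (mulb (bg τ h0) (bp τ h0))).2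
          have a2 := (abs_le.1 (mulb (be τ h0) (bm τ h0))).2
          have a3 := (abs_le.1 (mulb (mulb (be τ h0) (bp τ h0)) (bη τ h0))).1
          simp only [hK]; nlinarith
        have q7 : Real.exp (-l τ) * (g τ * p τ + e τ * m τ - e τ * p τ * η τ) ≤ κ * K :=
          (mul_le_mul_of_nonneg_left q6 (Real.exp_pos _).le).trans
            (mul_le_mul_of_nonneg_right (hy τ hτ) hKpos.le)
        nlinarith)
      have hNb : ∀ τ ∈ Set.Icc t (t + δ), |N τ| ≤ C * C * κ := by
        intro τ hτ
        have h0 := ht0.trans hτ.1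
        refine mulb (mulb (be τ h0) (bp τ h0)) ?_
        rw [abs_of_pos (Real.exp_pos _)]; exact hy τ hτ
      have n1 := (abs_le.1 (hNb t ⟨le_rfl, by linarith⟩)).2
      have n2 := (abs_le.1 (hNb (t+δ) ⟨by linarith, le_rfl⟩)).1
      have hT' := (hT t (t+δ) ht (by linarith)).trans_le (min_le_left _ _)
      nlinarith
    · have dE : ∀ t ∈ Set.Ici (0:ℝ), HasDerivWithinAt (fun t => e t ^ 2) (2 * (e t * (g t - p t * Real.exp (l t)))) (Set.Ici 0) t := by
        intro t ht
        refine ((he t ht).pow 2).congr_deriv ?_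
        norm_num; ring
      have hb : ∀ τ ∈ Set.Icc t (t + δ'), -(2 * C * E) ≤ 2 * (e τ * (g τ - p τ * Real.exp (l τ))) := by
        intro τ hτ
        have h0 := ht0.trans hτ.1
        have h1 := lup t τ ht0 hτ.1
        have h2 : C * (τ - t) ≤ C * 1 := by
          apply mul_le_mul_of_nonneg_left _ hC0.le; linarith [hτ.2]
        have h3 : |Real.exp (l τ)| ≤ Real.exp (Λ + C) := by
          rw [abs_of_pos (Real.exp_pos _)]
          apply Real.exp_le_exp.2; linarith
        have h4 := mulb (bp τ h0) h3
        have h5 : |g τ - p τ * Real.exp (l τ)| ≤ E :=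
          (abs_sub _ _).trans (add_le_add (bg τ h0) h4)
        have h6 := (abs_le.1 (mulb (be τ h0) h5)).1
        linarith
      have h1 := growth_le hV (c := -(ε/2)) ht0 (by linarith : t ≤ t + δ') (fun τ hτ => by
        have h0 := ht0.trans hτ.1
        have := growth_ge dE (c := -(2 * C * E)) ht0 hτ.1 (fun s hs => hb s ⟨hs.1, hs.2.trans hτ.2⟩)
        have q2 : 2 * C * E * (τ - t) ≤ 2 * C * E * δ' := by
          apply mul_le_mul_of_nonneg_left _ (by positivity); linarith [hτ.2]
        have q5 := bV τ h0
        linarith)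
      have hT' := (hT t (t+δ') ht (by linarith)).trans_le (min_le_right _ _)
      nlinarith
  rw [Metric.tendsto_atTop]
  intro ε hε
  obtain ⟨T, -, hT⟩ := main ((ε/2)^2) (by positivity)
  refine ⟨T, fun t ht => ?_⟩
  have := abs_le_of_sq_le_sq (hT t ht) (by positivity)
  rw [Real.dist_eq, sub_zero]
  linarith
lemma banach_stable {A : Type*} [NormedRing A] [NormedAlgebra ℂ A] [CompleteSpace A] [Nontrivial A]
    (a : A) (ha : ∀ z ∈ spectrum ℂ a, z.re < 0) :
    ∃ h : ℝ, 0 < h ∧ Tendsto (fun n : ℕ => (1 + (h:ℂ) • a)^n) atTop (nhds 0) := by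
  have hcpt := spectrum.isCompact (𝕜 := ℂ) a
  obtain ⟨z0, hz0, hmax⟩ := hcpt.exists_isMaxOn (spectrum.nonempty a) Complex.continuous_re.continuousOn
  obtain ⟨B, hB⟩ := hcpt.exists_bound_of_continuousOn (f := fun z => z) continuousOn_id
  set m := -z0.re with hm
  have hm0 : 0 < m := by have := ha z0 hz0; simp only [hm]; linarith
  set h : ℝ := m / (B^2 + 1) with hh
  have hpos : 0 < h := by positivity
  have hhB : h * B^2 ≤ m := by
    have : h * (B^2+1) = m := by rw [hh]; field_simp
    nlinarith
  refine ⟨h, hpos, ?_⟩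
  have hrad : spectralRadius ℂ (1 + (h:ℂ) • a) < ((1 : NNReal) : ENNReal) := by
    apply spectrum.spectralRadius_lt_of_forall_lt
    intro k hk
    have hne : (h:ℂ) ≠ 0 := by exact_mod_cast hpos.ne'
    have hk' : (k - 1) / h ∈ spectrum ℂ a := by
      rw [spectrum.mem_iff] at hk ⊢
      intro hu
      apply hk
      have : algebraMap ℂ A k - (1 + (h:ℂ) • a) = (Units.mk0 (h:ℂ) hne) • (algebraMap ℂ A ((k-1)/h) - a) := by
        rw [Units.smul_def, Units.val_mk0, smul_sub, Algebra.algebraMap_eq_smul_one,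
          Algebra.algebraMap_eq_smul_one, smul_smul, mul_div_cancel₀ _ hne, sub_smul, one_smul]
        abel
      rw [this]
      exact (isUnit_smul_iff _ _).2 hu
    set z := (k - 1) / h with hz
    have hkz : k = 1 + h * z := by rw [hz, mul_div_cancel₀ _ hne]; ring
    have h1 : z.re ≤ -m := by simpa [hm] using hmax hk'
    have h2 : ‖z‖ ≤ B := hB z hk'
    have h3 : ‖k‖^2 < 1 := by
      have e1 : ‖k‖^2 = (1 + h * z.re)^2 + (h * z.im)^2 := by
        rw [hkz, Complex.sq_norm, Complex.normSq_apply]; simp; ring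
      have e2 : ‖z‖^2 = z.re^2 + z.im^2 := by
        rw [Complex.sq_norm, Complex.normSq_apply]; ring
      have e3 : ‖z‖^2 ≤ B^2 := by gcongr
      rw [e1]
      have : (1 + h * z.re)^2 + (h * z.im)^2 = 1 + h * (2 * z.re + h * ‖z‖^2) := by rw [e2]; ring
      rw [this]
      have : h * ‖z‖^2 ≤ h * B^2 := by gcongr
      have : h * (2 * z.re + h * ‖z‖^2) < 0 := mul_neg_of_pos_of_neg hpos (by linarith)
      linarith
    rw [← NNReal.coe_lt_coe, coe_nnnorm, NNReal.coe_one]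
    nlinarith [norm_nonneg k]
  obtain ⟨r, hr1, hr2⟩ := ENNReal.lt_iff_exists_nnreal_btwn.1 hrad
  have hr3 : r < 1 := by exact_mod_cast hr2
  have hg := spectrum.pow_nnnorm_pow_one_div_tendsto_nhds_spectralRadius (1 + (h:ℂ) • a)
  have hev : ∀ᶠ n : ℕ in atTop, ‖(1 + (h:ℂ) • a)^n‖ ≤ (r:ℝ)^n := by
    filter_upwards [hg.eventually_lt_const hr1, eventually_gt_atTop 0] with n hn hn0
    have hn' : ((‖(1 + (h:ℂ) • a)^n‖₊ : ENNReal) ^ (1 / (n:ℝ))) ^ (n:ℝ) ≤ (r : ENNReal) ^ (n:ℝ) :=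
      ENNReal.rpow_le_rpow hn.le (by positivity)
    rw [← ENNReal.rpow_mul, one_div_mul_cancel (by positivity), ENNReal.rpow_one, ENNReal.rpow_natCast] at hn'
    have : ‖(1 + (h:ℂ) • a)^n‖₊ ≤ r^n := by exact_mod_cast hn'
    exact_mod_cast this
  exact squeeze_zero_norm' hev (tendsto_pow_atTop_nhds_zero_of_lt_one r.2 (by exact_mod_cast hr3))

attribute [local instance] Matrix.linftyOpNormedRing Matrix.linftyOpNormedAlgebra in
lemma hurwitz_pow {q : ℕ} (hq : 1 ≤ q) (F : Matrix (Fin q) (Fin q) ℝ) (hF : IsHurwitz F) :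
    ∃ h : ℝ, 0 < h ∧ ∀ κ > 0, ∃ N : ℕ, 1 ≤ N ∧ ∀ i j, |((1 + h • F)^N) i j| ≤ κ := by
  have : Nonempty (Fin q) := ⟨⟨0, hq⟩⟩
  obtain ⟨h, hpos, ht⟩ := banach_stable (F.map (algebraMap ℝ ℂ)) hF
  refine ⟨h, hpos, fun κ hκ => ?_⟩
  have hmap : ∀ n : ℕ, (1 + (h:ℂ) • F.map (algebraMap ℝ ℂ))^n = ((1 + h • F)^n).map (algebraMap ℝ ℂ) := by
    intro n
    have h1 : (1 + (h:ℂ) • F.map (algebraMap ℝ ℂ)) = (algebraMap ℝ ℂ).mapMatrix (1 + h • F) := by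
      ext i j
      simp [Matrix.one_apply, apply_ite]
    rw [h1, ← map_pow]; rfl
  have hev : ∀ i j, ∀ᶠ n : ℕ in atTop, |((1 + h • F)^n) i j| < κ := by
    intro i j
    have h1 : Tendsto (fun n : ℕ => ((1 + (h:ℂ) • F.map (algebraMap ℝ ℂ))^n) i j) atTop (nhds 0) := by
      have hc : Continuous (fun M : Matrix (Fin q) (Fin q) ℂ => M i j) := by fun_prop
      exact (hc.tendsto 0).comp ht
    have h2 := h1.norm
    rw [norm_zero] at h2
    filter_upwards [h2.eventually_lt_const hκ] with n hn
    rw [hmap] at hn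
    simpa using hn
  have := (eventually_all.2 fun i => eventually_all.2 fun j => hev i j).and (eventually_ge_atTop 1)
  obtain ⟨N, hN, hN1⟩ := this.exists
  exact ⟨N, hN1, fun i j => (hN i j).le⟩

lemma dot_nonneg {q : ℕ} (v : Fin q → ℝ) : 0 ≤ v ⬝ᵥ v := by
  simp only [dotProduct]; exact Finset.sum_nonneg fun i _ => mul_self_nonneg _

lemma dot_sq_le {q : ℕ} (u v : Fin q → ℝ) : (u ⬝ᵥ v)^2 ≤ (u ⬝ᵥ u) * (v ⬝ᵥ v) := by
  simp only [dotProduct]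
  simpa [sq] using Finset.sum_mul_sq_le_sq_mul_sq Finset.univ u v

lemma mulVec_bound {q : ℕ} (B : Matrix (Fin q) (Fin q) ℝ) {κ : ℝ} (hB : ∀ i j, |B i j| ≤ κ)
    (v : Fin q → ℝ) : (B *ᵥ v) ⬝ᵥ (B *ᵥ v) ≤ (q * (q * κ^2)) * (v ⬝ᵥ v) := by
  have hrow : ∀ i, (B *ᵥ v) i * (B *ᵥ v) i ≤ (q * κ^2) * (v ⬝ᵥ v) := by
    intro i
    have h1 := dot_sq_le (B i) v
    have h2 : B i ⬝ᵥ B i ≤ q * κ^2 := by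
      simp only [dotProduct]
      calc ∑ j, B i j * B i j ≤ ∑ j : Fin q, κ^2 := by
            apply Finset.sum_le_sum; intro j _
            have := abs_le.1 (hB i j)
            nlinarith
        _ = q * κ^2 := by simp
    have h3 : (B *ᵥ v) i = B i ⬝ᵥ v := rfl
    rw [h3, ← sq]
    exact h1.trans (mul_le_mul_of_nonneg_right h2 (dot_nonneg v))
  calc (B *ᵥ v) ⬝ᵥ (B *ᵥ v) = ∑ i, (B *ᵥ v) i * (B *ᵥ v) i := rfl
    _ ≤ ∑ i : Fin q, (q * κ^2) * (v ⬝ᵥ v) := Finset.sum_le_sum fun i _ => hrow i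
    _ = _ := by simp; ring

lemma exists_lyapunov {q : ℕ} (hq : 1 ≤ q) (F : Matrix (Fin q) (Fin q) ℝ) (hF : IsHurwitz F) :
    ∃ P : Matrix (Fin q) (Fin q) ℝ, (∀ u v, u ⬝ᵥ P *ᵥ v = v ⬝ᵥ P *ᵥ u) ∧ (∀ z, z ⬝ᵥ z ≤ z ⬝ᵥ P *ᵥ z) ∧
      ∃ a > 0, ∀ z, z ⬝ᵥ P *ᵥ (F *ᵥ z) ≤ -a * (z ⬝ᵥ z) := by
  obtain ⟨h, hpos, hN⟩ := hurwitz_pow hq F hF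
  have hq0 : (0:ℝ) < q := by exact_mod_cast hq
  obtain ⟨N, hN1, hN⟩ := hN (1 / (2 * q)) (by positivity)
  set A := 1 + h • F with hA
  set P : Matrix (Fin q) (Fin q) ℝ := ∑ n ∈ Finset.range N, (A^n)ᵀ * A^n with hP
  have hform : ∀ u v, u ⬝ᵥ P *ᵥ v = ∑ n ∈ Finset.range N, (A^n *ᵥ u) ⬝ᵥ (A^n *ᵥ v) := by
    intro u v
    rw [hP, Matrix.sum_mulVec, dotProduct_sum]
    apply Finset.sum_congr rfl
    intro n _
    rw [← Matrix.mulVec_mulVec, Matrix.dotProduct_mulVec, Matrix.vecMul_transpose]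
  have hsymm : ∀ u v, u ⬝ᵥ P *ᵥ v = v ⬝ᵥ P *ᵥ u := by
    intro u v; rw [hform, hform]
    exact Finset.sum_congr rfl fun n _ => dotProduct_comm _ _
  refine ⟨P, hsymm, ?_, 1 / (4 * h), by positivity, ?_⟩
  · intro z
    rw [hform]
    have := Finset.single_le_sum (f := fun n => (A^n *ᵥ z) ⬝ᵥ (A^n *ᵥ z)) (s := Finset.range N)
      (fun n _ => dot_nonneg _) (Finset.mem_range.2 (by omega : 0 < N))
    simpa using this
  · intro z
    have h1 : (A *ᵥ z) ⬝ᵥ P *ᵥ (A *ᵥ z) = z ⬝ᵥ P *ᵥ z - z ⬝ᵥ z + (A^N *ᵥ z) ⬝ᵥ (A^N *ᵥ z) := by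
      rw [hform, hform]
      have e1 : ∀ n, A^n *ᵥ (A *ᵥ z) = A^(n+1) *ᵥ z := by
        intro n; rw [Matrix.mulVec_mulVec, pow_succ]
      simp only [e1]
      have := Finset.sum_range_succ' (fun n => (A^n *ᵥ z) ⬝ᵥ (A^n *ᵥ z)) N
      rw [Finset.sum_range_succ] at this
      simp only [pow_zero, one_mulVec] at this
      linarith
    have h2 : A *ᵥ z = z + h • (F *ᵥ z) := by
      rw [hA, Matrix.add_mulVec, Matrix.one_mulVec, Matrix.smul_mulVec]
    have h3 : (A *ᵥ z) ⬝ᵥ P *ᵥ (A *ᵥ z) = z ⬝ᵥ P *ᵥ z + 2 * h * (z ⬝ᵥ P *ᵥ (F *ᵥ z)) + h^2 * ((F *ᵥ z) ⬝ᵥ P *ᵥ (F *ᵥ z)) := by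
      rw [h2, Matrix.mulVec_add, Matrix.mulVec_smul, add_dotProduct, dotProduct_add, dotProduct_add,
        smul_dotProduct, dotProduct_smul, dotProduct_smul, smul_dotProduct, hsymm (F *ᵥ z) z]
      simp only [smul_eq_mul]; ring
    have h4 := mulVec_bound (A^N) hN z
    have h5 : (q:ℝ) * (q * (1 / (2 * q))^2) = 1/4 := by field_simp; norm_num
    rw [h5] at h4
    have h6 : 0 ≤ (F *ᵥ z) ⬝ᵥ P *ᵥ (F *ᵥ z) := by
      rw [hform]; exact Finset.sum_nonneg fun n _ => dot_nonneg _
    have h7 : 2 * h * (z ⬝ᵥ P *ᵥ (F *ᵥ z)) ≤ - (1/2) * (z ⬝ᵥ z) := by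
      have := dot_nonneg z
      nlinarith [mul_nonneg (sq_nonneg h) h6]
    have : -(1 / (4 * h)) * (z ⬝ᵥ z) = (-(1/2) * (z ⬝ᵥ z)) / (2 * h) := by field_simp; ring
    rw [this, le_div_iff₀ (by positivity)]
    linarith

noncomputable def nr {q : ℕ} (v : Fin q → ℝ) : ℝ := √(v ⬝ᵥ v)

lemma nr_nonneg {q : ℕ} (v : Fin q → ℝ) : 0 ≤ nr v := Real.sqrt_nonneg _

lemma nr_sq {q : ℕ} (v : Fin q → ℝ) : nr v ^ 2 = v ⬝ᵥ v := Real.sq_sqrt (dot_nonneg v)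

lemma abs_dot_le {q : ℕ} (u v : Fin q → ℝ) : |u ⬝ᵥ v| ≤ nr u * nr v := by
  apply abs_le_of_sq_le_sq _ (mul_nonneg (nr_nonneg _) (nr_nonneg _))
  rw [mul_pow, nr_sq, nr_sq]
  exact dot_sq_le u v

lemma exists_nr_mulVec_le {q : ℕ} (B : Matrix (Fin q) (Fin q) ℝ) :
    ∃ c : ℝ, 0 ≤ c ∧ ∀ v, nr (B *ᵥ v) ≤ c * nr v := by
  set κ := ∑ i, ∑ j, |B i j| with hκ
  have hB : ∀ i j, |B i j| ≤ κ := by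
    intro i j
    calc |B i j| ≤ ∑ j, |B i j| :=
          Finset.single_le_sum (f := fun j => |B i j|) (fun _ _ => abs_nonneg _) (Finset.mem_univ j)
      _ ≤ κ := Finset.single_le_sum (f := fun i => ∑ j, |B i j|)
          (fun _ _ => Finset.sum_nonneg fun _ _ => abs_nonneg _) (Finset.mem_univ i)
  have hκ0 : 0 ≤ κ := Finset.sum_nonneg fun _ _ => Finset.sum_nonneg fun _ _ => abs_nonneg _
  refine ⟨q * κ, by positivity, fun v => ?_⟩
  apply le_of_sq_le_sq _ (mul_nonneg (by positivity) (nr_nonneg _))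
  rw [mul_pow, nr_sq, nr_sq]
  have := mulVec_bound B hB v
  linarith

lemma deriv_dot {q : ℕ} {u v : ℝ → Fin q → ℝ} {u' v' : Fin q → ℝ} {s : Set ℝ} {t : ℝ}
    (hu : HasDerivWithinAt u u' s t) (hv : HasDerivWithinAt v v' s t) :
    HasDerivWithinAt (fun t => u t ⬝ᵥ v t) (u' ⬝ᵥ v t + u t ⬝ᵥ v') s t := by
  have h := HasDerivWithinAt.fun_sum (u := Finset.univ) (A := fun i t => u t i * v t i)
    (A' := fun i => u' i * v t i + u t i * v' i) (s := s) (x := t)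
    (fun i _ => ((hasDerivWithinAt_pi.1 hu) i).mul ((hasDerivWithinAt_pi.1 hv) i))
  refine h.congr_deriv ?_
  rw [Finset.sum_add_distrib]; rfl

lemma deriv_mulVec {q : ℕ} (B : Matrix (Fin q) (Fin q) ℝ) {v : ℝ → Fin q → ℝ} {v' : Fin q → ℝ}
    {s : Set ℝ} {t : ℝ} (hv : HasDerivWithinAt v v' s t) :
    HasDerivWithinAt (fun t => B *ᵥ v t) (B *ᵥ v') s t := by
  rw [hasDerivWithinAt_pi]
  intro i
  have := deriv_dot (hasDerivWithinAt_const t s (B i)) hv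
  refine this.congr_deriv ?_
  simp only [zero_dotProduct, zero_add]; rfl

lemma lyap_ineq {a B k d Kx αx e x n ψ zf zb zg : ℝ} (ha : 0 < a)
    (hk : 1 + 2 * B^2 / a ≤ k) (hd : B^2 / a + αx^2 ≤ 2 * d * Kx)
    (hψ : |ψ| ≤ B * n) (hzf : zf ≤ -a * n^2) (hzb : |zb| ≤ B * n) (hzg : |zg| ≤ B * n) :
    -2 * k * e^2 + 2 * αx * e * x - 2 * e * ψ + 2 * zf - 2 * e * zb + 2 * x * zg
      - 2 * d * Kx * x^2 ≤ -e^2 := by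
  have m1 : ∀ {y u : ℝ}, |u| ≤ B * n → |y * u| ≤ |y| * (B * n) := by
    intro y u h; rw [abs_mul]; exact mul_le_mul_of_nonneg_left h (abs_nonneg _)
  have h1 := (abs_le.1 (m1 (y := e) hψ)).1
  have h2 := (abs_le.1 (m1 (y := e) hzb)).1
  have h3 := (abs_le.1 (m1 (y := x) hzg)).2
  have y1 : 4 * (|e| * (B * n)) ≤ a * n^2 + 4 * (B^2 / a * e^2) := by
    have : a * n^2 + 4 * (B^2 / a * e^2) - 4 * (|e| * (B * n)) = (a * n - 2 * B * |e|)^2 / a := by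
      rw [← sq_abs e]; field_simp; ring
    have : 0 ≤ (a * n - 2 * B * |e|)^2 / a := by positivity
    linarith
  have y2 : 2 * (|x| * (B * n)) ≤ a * n^2 + B^2 / a * x^2 := by
    have : a * n^2 + B^2 / a * x^2 - 2 * (|x| * (B * n)) = (a * n - B * |x|)^2 / a := by
      rw [← sq_abs x]; field_simp; ring
    have : 0 ≤ (a * n - B * |x|)^2 / a := by positivity
    linarith
  have y3 : 2 * αx * e * x ≤ e^2 + αx^2 * x^2 := by nlinarith [sq_nonneg (e - αx * x)]
  have y4 : (1 + 2 * (B^2 / a)) * e^2 ≤ k * e^2 :=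
    mul_le_mul_of_nonneg_right (by rw [← mul_div_assoc]; exact hk) (sq_nonneg e)
  have y5 := mul_le_mul_of_nonneg_right hd (sq_nonneg x)
  nlinarith

theorem adaptive_internal_model_regulation (q : ℕ) (hq : 1 ≤ q)
    (P : Set (ℝ × (Fin q → ℝ))) (hP : IsCompact P)
    (F : Matrix (Fin q) (Fin q) ℝ) (hF : IsHurwitz F)
    (G : Fin q → ℝ) (Kx αx : ℝ) (hKx : 0 < Kx) :
    ∃ KeStar : ℝ, 0 < KeStar ∧ ∀ Ke : ℝ, KeStar ≤ Ke →
      ∀ Ktilde : ℝ, ∀ Ψ : Fin q → ℝ, (Ktilde, Ψ) ∈ P →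
      ∀ (e : ℝ → ℝ) (what w : ℝ → Fin q → ℝ) (xtil : ℝ → ℝ) (Psihat : ℝ → Fin q → ℝ),
        (∀ t ∈ Set.Ici (0 : ℝ), HasDerivWithinAt e
          (-(Ktilde + Ke) * e t + αx * xtil t - Psihat t ⬝ᵥ what t + Ψ ⬝ᵥ w t)
          (Set.Ici (0 : ℝ)) t) →
        (∀ t ∈ Set.Ici (0 : ℝ), HasDerivWithinAt what
          (F.mulVec (what t) + (Psihat t ⬝ᵥ what t) • G + (Ke * e t) • G)
          (Set.Ici (0 : ℝ)) t) →
        (∀ t ∈ Set.Ici (0 : ℝ), HasDerivWithinAt xtil (-Kx * xtil t)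
          (Set.Ici (0 : ℝ)) t) →
        (∀ t ∈ Set.Ici (0 : ℝ), HasDerivWithinAt Psihat (e t • what t)
          (Set.Ici (0 : ℝ)) t) →
        (∀ t ∈ Set.Ici (0 : ℝ), HasDerivWithinAt w
          (F.mulVec (w t) + (Ψ ⬝ᵥ w t) • G) (Set.Ici (0 : ℝ)) t) →
        Tendsto e atTop (nhds 0) := by
  obtain ⟨M, hsym, hM1, a, ha, hMF⟩ := exists_lyapunov hq F hF
  obtain ⟨C1, hC1⟩ := hP.exists_bound_of_continuousOn (f := fun p => p.2 ⬝ᵥ G - p.1)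
    (by apply Continuous.continuousOn; fun_prop)
  obtain ⟨B1, hB1⟩ := hP.exists_bound_of_continuousOn (f := fun p => nr p.2)
    (by apply Continuous.continuousOn; unfold nr; fun_prop)
  obtain ⟨B2, hB2⟩ := hP.exists_bound_of_continuousOn
    (f := fun p => nr (M *ᵥ (F *ᵥ G + p.1 • G)))
    (by apply Continuous.continuousOn; unfold nr; fun_prop)
  set B : ℝ := |B1| + |B2| + nr (M *ᵥ (αx • G)) with hB
  have hBn : 0 ≤ B := by have := nr_nonneg (M *ᵥ (αx • G)); positivity
  refine ⟨1 + 2 * B^2 / a + |C1|, by positivity, ?_⟩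
  intro Ke hKe Kt Ψ hmem e what w x Ph he hwh hx hPh hw
  have hk : 1 + 2 * B^2 / a ≤ Kt + Ke - Ψ ⬝ᵥ G := by
    have h1 := hC1 _ hmem
    simp only [Real.norm_eq_abs] at h1
    have := (abs_le.1 (h1.trans (le_abs_self C1))).2
    linarith
  set k := Kt + Ke - Ψ ⬝ᵥ G with hkdef
  have hΨB : nr Ψ ≤ B := by
    have h1 := hB1 _ hmem
    simp only [Real.norm_eq_abs] at h1
    have := (le_abs_self _).trans (h1.trans (le_abs_self B1))
    have := nr_nonneg (M *ᵥ (αx • G)); have := abs_nonneg B2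
    linarith
  set b := F *ᵥ G + Kt • G with hb
  have hbB : nr (M *ᵥ b) ≤ B := by
    have h1 := hB2 _ hmem
    simp only [Real.norm_eq_abs] at h1
    have := (le_abs_self _).trans (h1.trans (le_abs_self B2))
    have := nr_nonneg (M *ᵥ (αx • G)); have := abs_nonneg B1
    linarith
  have hgB : nr (M *ᵥ (αx • G)) ≤ B := by
    have := abs_nonneg B1; have := abs_nonneg B2
    linarith
  set d : ℝ := (B^2 / a + αx^2) / (2 * Kx) + 1 with hd
  have hd1 : 1 ≤ d := by
    have : 0 ≤ (B^2 / a + αx^2) / (2 * Kx) := by positivity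
    linarith
  have hd2 : B^2 / a + αx^2 ≤ 2 * d * Kx := by
    have : 2 * d * Kx = B^2 / a + αx^2 + 2 * Kx := by rw [hd]; field_simp
    linarith
  set φ : ℝ → Fin q → ℝ := fun t => Ph t - Ψ with hφ
  set z : ℝ → Fin q → ℝ := fun t => what t - w t + e t • G with hz
  have dφ : ∀ t ∈ Set.Ici (0:ℝ), HasDerivWithinAt φ (e t • what t) (Set.Ici 0) t :=
    fun t ht => (hPh t ht).sub_const Ψ
  have dz : ∀ t ∈ Set.Ici (0:ℝ), HasDerivWithinAt z (F *ᵥ z t - e t • b + x t • (αx • G)) (Set.Ici 0) t := by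
    intro t ht
    have h := ((hwh t ht).sub (hw t ht)).add ((he t ht).smul_const G)
    refine h.congr_deriv ?_
    simp only [hz, hb, Matrix.mulVec_add, Matrix.mulVec_sub, Matrix.mulVec_smul]
    ext i
    simp only [Pi.add_apply, Pi.sub_apply, Pi.smul_apply, smul_eq_mul]
    ring
  have hwhat : ∀ t, what t = z t + w t - e t • G := by
    intro t; simp only [hz]; abel
  have hPht : ∀ t, Ph t = φ t + Ψ := by intro t; simp only [hφ]; abel
  have de : ∀ t ∈ Set.Ici (0:ℝ), HasDerivWithinAt e
      (-k * e t + αx * x t - φ t ⬝ᵥ what t - Ψ ⬝ᵥ z t) (Set.Ici 0) t := by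
    intro t ht
    refine (he t ht).congr_deriv ?_
    have h1 : Ψ ⬝ᵥ what t = Ψ ⬝ᵥ z t + Ψ ⬝ᵥ w t - e t * (Ψ ⬝ᵥ G) := by
      rw [hwhat t, dotProduct_sub, dotProduct_add, dotProduct_smul, smul_eq_mul]
    rw [hPht t, add_dotProduct, h1, hkdef]; ring
  set V : ℝ → ℝ := fun t => e t ^ 2 + φ t ⬝ᵥ φ t + z t ⬝ᵥ M *ᵥ z t + d * x t ^ 2 with hV
  set V' : ℝ → ℝ := fun t => -2 * k * e t ^ 2 + 2 * αx * e t * x t - 2 * e t * (Ψ ⬝ᵥ z t)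
      + 2 * (z t ⬝ᵥ M *ᵥ (F *ᵥ z t)) - 2 * e t * (z t ⬝ᵥ M *ᵥ b) + 2 * x t * (z t ⬝ᵥ M *ᵥ (αx • G))
      - 2 * d * Kx * x t ^ 2 with hV'
  have dV : ∀ t ∈ Set.Ici (0:ℝ), HasDerivWithinAt V (V' t) (Set.Ici 0) t := by
    intro t ht
    have h := ((((de t ht).pow 2).add (deriv_dot (dφ t ht) (dφ t ht))).add
      (deriv_dot (dz t ht) (deriv_mulVec M (dz t ht)))).add (((hx t ht).pow 2).const_mul d)
    refine h.congr_deriv ?_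
    rw [hsym _ (z t)]
    simp only [hV', Matrix.mulVec_add, Matrix.mulVec_sub, dotProduct_add, dotProduct_sub,
      Matrix.mulVec_smul M (e t), Matrix.mulVec_smul M (x t), dotProduct_smul, smul_dotProduct, smul_eq_mul,
      dotProduct_comm (what t) (φ t)]
    norm_num
    ring
  have bV : ∀ t, 0 ≤ t → V' t ≤ -(e t)^2 := by
    intro t _
    apply lyap_ineq (n := nr (z t)) ha hk hd2
    · exact (abs_dot_le _ _).trans (mul_le_mul_of_nonneg_right hΨB (nr_nonneg _))
    · rw [nr_sq]; exact hMF _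
    · rw [dotProduct_comm]
      exact (abs_dot_le _ _).trans (mul_le_mul_of_nonneg_right hbB (nr_nonneg _))
    · rw [dotProduct_comm]
      exact (abs_dot_le _ _).trans (mul_le_mul_of_nonneg_right hgB (nr_nonneg _))
  have hVle : ∀ t, 0 ≤ t → V t ≤ V 0 := by
    intro t ht
    have := growth_le dV (c := 0) le_rfl ht (fun s hs => by
      have := bV s hs.1; nlinarith [sq_nonneg (e s)])
    linarith
  have hzM : ∀ t, 0 ≤ z t ⬝ᵥ M *ᵥ z t := fun t => (dot_nonneg _).trans (hM1 _)
  have hdx : ∀ t, x t ^ 2 ≤ d * x t ^ 2 := fun t => by nlinarith [sq_nonneg (x t)]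
  have hV0 : ∀ t, 0 ≤ t → 0 ≤ V t := by
    intro t _
    have h1 := dot_nonneg (φ t); have h2 := hzM t; have h3 := hdx t
    have h4 := sq_nonneg (e t); have h5 := sq_nonneg (x t)
    simp only [hV]; linarith
  set R : ℝ := √(V 0) with hR
  have hR0 : 0 ≤ R := Real.sqrt_nonneg _
  have hRsq : R^2 = V 0 := Real.sq_sqrt (hV0 0 le_rfl)
  have bnd : ∀ t, 0 ≤ t → |e t| ≤ R ∧ nr (φ t) ≤ R ∧ nr (z t) ≤ R ∧ |x t| ≤ R := by
    intro t ht
    have h1 := dot_nonneg (φ t); have h2 := hM1 (z t); have h3 := hdx t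
    have h4 := sq_nonneg (e t); have h5 := sq_nonneg (x t); have h6 := dot_nonneg (z t)
    have h7 := hVle t ht
    rw [← hRsq] at h7
    simp only [hV] at h7
    refine ⟨abs_le_of_sq_le_sq (by linarith) hR0, le_of_sq_le_sq (by rw [nr_sq]; linarith) hR0,
      le_of_sq_le_sq (by rw [nr_sq]; linarith) hR0, abs_le_of_sq_le_sq (by linarith) hR0⟩
  -- the exosystem
  set A : Matrix (Fin q) (Fin q) ℝ := F + Matrix.vecMulVec G Ψ with hA
  have hAw : ∀ v, F *ᵥ v + (Ψ ⬝ᵥ v) • G = A *ᵥ v := by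
    intro v
    rw [hA, Matrix.add_mulVec, Matrix.vecMulVec_mulVec]
    simp
  obtain ⟨Ca, hCa0, hCa⟩ := exists_nr_mulVec_le A
  have dw : ∀ t ∈ Set.Ici (0:ℝ), HasDerivWithinAt w (A *ᵥ w t) (Set.Ici 0) t := by
    intro t ht; rw [← hAw]; exact hw t ht
  set D : ℝ → ℝ := fun t => 1 + w t ⬝ᵥ w t with hD
  have hD1 : ∀ t, 1 ≤ D t := fun t => by have := dot_nonneg (w t); simp only [hD]; linarith
  have hD0 : ∀ t, 0 < D t := fun t => by linarith [hD1 t]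
  set l : ℝ → ℝ := fun t => Real.log (D t) / 2 with hl
  set η : ℝ → ℝ := fun t => (w t ⬝ᵥ A *ᵥ w t) / D t with hη
  have dl : ∀ t ∈ Set.Ici (0:ℝ), HasDerivWithinAt l (η t) (Set.Ici 0) t := by
    intro t ht
    have h := (((deriv_dot (dw t ht) (dw t ht)).const_add 1).log (hD0 t).ne').div_const 2
    refine h.congr_deriv ?_
    rw [dotProduct_comm (A *ᵥ w t)]
    simp only [hη, hD]; ring
  have hexp2 : ∀ t, Real.exp (l t) ^ 2 = D t := by
    intro t
    rw [← Real.exp_nat_mul]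
    simp only [hl]
    rw [show ((2:ℕ):ℝ) * (Real.log (D t) / 2) = Real.log (D t) by push_cast; ring, Real.exp_log (hD0 t)]
  have hinv : ∀ t, Real.exp (l t) * Real.exp (-l t) = 1 := fun t => by rw [← Real.exp_add]; simp
  have hy1 : ∀ t, Real.exp (-l t) ≤ 1 := by
    intro t
    rw [Real.exp_le_one_iff]
    have := Real.log_nonneg (hD1 t)
    simp only [hl]; linarith
  have hy0 : ∀ t, 0 < Real.exp (-l t) := fun t => Real.exp_pos _
  have hwy : ∀ t, nr (w t) * Real.exp (-l t) ≤ 1 := by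
    intro t
    rw [← hinv t]
    apply mul_le_mul_of_nonneg_right _ (hy0 t).le
    apply le_of_sq_le_sq _ (Real.exp_pos _).le
    rw [nr_sq, hexp2]; simp only [hD]; linarith
  have hvy : ∀ (v : Fin q → ℝ) t, |v ⬝ᵥ w t * Real.exp (-l t)| ≤ nr v := by
    intro v t
    rw [abs_mul, abs_of_pos (hy0 t)]
    calc _ ≤ nr v * nr (w t) * Real.exp (-l t) := mul_le_mul_of_nonneg_right (abs_dot_le _ _) (hy0 t).le
      _ = nr v * (nr (w t) * Real.exp (-l t)) := by ring
      _ ≤ nr v * 1 := mul_le_mul_of_nonneg_left (hwy t) (nr_nonneg _)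
      _ = nr v := mul_one _
  have hvAy : ∀ (v : Fin q → ℝ) t, |v ⬝ᵥ A *ᵥ w t * Real.exp (-l t)| ≤ nr v * Ca := by
    intro v t
    rw [abs_mul, abs_of_pos (hy0 t)]
    calc _ ≤ nr v * nr (A *ᵥ w t) * Real.exp (-l t) := mul_le_mul_of_nonneg_right (abs_dot_le _ _) (hy0 t).le
      _ ≤ nr v * (Ca * nr (w t)) * Real.exp (-l t) := by
          apply mul_le_mul_of_nonneg_right _ (hy0 t).le
          exact mul_le_mul_of_nonneg_left (hCa _) (nr_nonneg _)
      _ = (nr v * Ca) * (nr (w t) * Real.exp (-l t)) := by ring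
      _ ≤ (nr v * Ca) * 1 := mul_le_mul_of_nonneg_left (hwy t) (mul_nonneg (nr_nonneg _) hCa0)
      _ = _ := mul_one _
  have mulb : ∀ {a b A B : ℝ}, |a| ≤ A → |b| ≤ B → |a * b| ≤ A * B := by
    intro a b A B h1 h2
    rw [abs_mul]; exact mul_le_mul h1 h2 (abs_nonneg _) ((abs_nonneg _).trans h1)
  have addb : ∀ {a b A B : ℝ}, |a| ≤ A → |b| ≤ B → |a + b| ≤ A + B := fun h1 h2 =>
    (abs_add_le _ _).trans (add_le_add h1 h2)
  have subb : ∀ {a b A B : ℝ}, |a| ≤ A → |b| ≤ B → |a - b| ≤ A + B := fun h1 h2 =>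
    (abs_sub _ _).trans (add_le_add h1 h2)
  have bη : ∀ t, |η t| ≤ Ca := by
    intro t
    simp only [hη]
    rw [abs_div, abs_of_pos (hD0 t), div_le_iff₀ (hD0 t)]
    have h1 := (abs_dot_le (w t) (A *ᵥ w t)).trans (mul_le_mul_of_nonneg_left (hCa (w t)) (nr_nonneg _))
    have h2 : nr (w t) * (Ca * nr (w t)) = Ca * (w t ⬝ᵥ w t) := by rw [← nr_sq]; ring
    rw [h2] at h1
    simp only [hD]; linarith
  set p : ℝ → ℝ := fun t => φ t ⬝ᵥ w t * Real.exp (-l t) with hp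
  have bp : ∀ t, 0 ≤ t → |p t| ≤ R := fun t ht => (hvy (φ t) t).trans (bnd t ht).2.1
  set g : ℝ → ℝ := fun t => -k * e t + αx * x t - (φ t ⬝ᵥ z t - e t * (φ t ⬝ᵥ G)) - Ψ ⬝ᵥ z t with hg
  set m : ℝ → ℝ := fun t => φ t ⬝ᵥ A *ᵥ w t * Real.exp (-l t)
    + e t * (z t ⬝ᵥ w t * Real.exp (-l t) - e t * (G ⬝ᵥ w t * Real.exp (-l t)) - Real.exp (-l t))
    - p t * η t with hm
  have de2 : ∀ t ∈ Set.Ici (0:ℝ), HasDerivWithinAt e (g t - p t * Real.exp (l t)) (Set.Ici 0) t := by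
    intro t ht
    refine (de t ht).congr_deriv ?_
    have h1 : φ t ⬝ᵥ what t = φ t ⬝ᵥ z t + φ t ⬝ᵥ w t - e t * (φ t ⬝ᵥ G) := by
      rw [hwhat t, dotProduct_sub, dotProduct_add, dotProduct_smul, smul_eq_mul]
    rw [h1]
    simp only [hg, hp]
    linear_combination (φ t ⬝ᵥ w t) * hinv t
  have dp : ∀ t ∈ Set.Ici (0:ℝ), HasDerivWithinAt p (e t * Real.exp (l t) + m t) (Set.Ici 0) t := by
    intro t ht
    have h := (deriv_dot (dφ t ht) (dw t ht)).mul ((dl t ht).neg.exp)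
    refine h.congr_deriv ?_
    have h1 : what t ⬝ᵥ w t = z t ⬝ᵥ w t + w t ⬝ᵥ w t - e t * (G ⬝ᵥ w t) := by
      rw [hwhat t, sub_dotProduct, add_dotProduct, smul_dotProduct, smul_eq_mul]
    have h2 : w t ⬝ᵥ w t = Real.exp (l t) ^ 2 - 1 := by rw [hexp2]; simp only [hD]; ring
    rw [smul_dotProduct, smul_eq_mul, h1, h2]
    simp only [hm, hp, Pi.neg_apply]
    linear_combination e t * Real.exp (l t) * hinv t
  have bg : ∀ t, 0 ≤ t → |g t| ≤ |-k| * R + |αx| * R + (R * R + R * (R * nr G)) + nr Ψ * R := by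
    intro t ht
    obtain ⟨b1, b2, b3, b4⟩ := bnd t ht
    refine subb (subb (addb (mulb le_rfl b1) (mulb le_rfl b4)) (subb ?_ (mulb b1 ?_))) ?_
    · exact (abs_dot_le _ _).trans (mul_le_mul b2 b3 (nr_nonneg _) hR0)
    · exact (abs_dot_le _ _).trans (mul_le_mul_of_nonneg_right b2 (nr_nonneg _))
    · exact (abs_dot_le _ _).trans (mul_le_mul_of_nonneg_left b3 (nr_nonneg _))
  have bm : ∀ t, 0 ≤ t → |m t| ≤ R * Ca + R * (R + R * nr G + 1) + R * Ca := by
    intro t ht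
    obtain ⟨b1, b2, b3, b4⟩ := bnd t ht
    refine subb (addb ?_ (mulb b1 (subb (subb ((hvy _ _).trans b3) (mulb b1 (hvy _ _))) ?_)))
      (mulb (bp t ht) (bη t))
    · exact (hvAy _ _).trans (mul_le_mul_of_nonneg_right b2 hCa0)
    · rw [abs_of_pos (hy0 t)]; exact hy1 t
  set Cg := |-k| * R + |αx| * R + (R * R + R * (R * nr G)) + nr Ψ * R with hCg
  set Cm := R * Ca + R * (R + R * nr G + 1) + R * Ca with hCm
  have hCg0 : 0 ≤ Cg := (abs_nonneg _).trans (bg 0 le_rfl)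
  have hCm0 : 0 ≤ Cm := (abs_nonneg _).trans (bm 0 le_rfl)
  exact scalar_core (C := 1 + R + Ca + Cg + Cm) (by linarith) de2 dp dl dV bV hV0
    (fun t ht => (bnd t ht).1.trans (by linarith)) (fun t ht => (bp t ht).trans (by linarith))
    (fun t ht => (bg t ht).trans (by linarith)) (fun t ht => (bm t ht).trans (by linarith))
    (fun t _ => (bη t).trans (by linarith))
end
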